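/- Assume q > p_2 and k[D_σ] has the WLP. Then k[D] has the WLP. -/

import Mathlib

open MvPolynomial

set_option synthInstance.maxHeartbeats 1000000
set_option maxHeartbeats 1000000

noncomputable section

namespace SRWLP

variable (k : Type) [Field k]

/-- An (abstract) simplicial complex on the vertex set `Fin n`:
a collection of finite subsets (faces) closed under passing to subsets. -/
structure SC (n : ℕ) where
  faces : Finset (Finset (Fin n))
  down_closed : ∀ s ∈ faces, ∀ t ⊆ s, t ∈ faces

variable {n : ℕ}

/-- `dimP D = dim D + 1`, i.e. the maximal cardinality of a face of `D`. -/
def dimP (D : SC n) : ℕ := D.faces.sup Finset.card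

/-- The Stanley–Reisner ideal of `D`: the ideal generated by the squarefree
monomials corresponding to non-faces. -/
def srIdeal (D : SC n) : Ideal (MvPolynomial (Fin n) k) :=
  Ideal.span { p | ∃ s : Finset (Fin n), s ∉ D.faces ∧ p = ∏ i ∈ s, X i }

/-- `x_σ`, the product of the variables indexed by the face `σ`. -/
def xFace (σ : Finset (Fin n)) : MvPolynomial (Fin n) k := ∏ i ∈ σ, X i

variable {ι : Type} [Fintype ι]

/-- The degree-`m` graded component of the standard graded algebra
`k[Xᵢ : i ∈ ι] ⧸ J`, as a `k`-submodule. -/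
def qComp (J : Ideal (MvPolynomial ι k)) (m : ℕ) :
    Submodule k (MvPolynomial ι k ⧸ J) :=
  (homogeneousSubmodule ι k m).map (Ideal.Quotient.mkₐ k J).toLinearMap

/-- Graded components indexed by `ℤ` (zero in negative degrees). -/
def qCompZ (J : Ideal (MvPolynomial ι k)) (m : ℤ) :
    Submodule k (MvPolynomial ι k ⧸ J) :=
  if 0 ≤ m then qComp k J m.toNat else ⊥

/-- The Hilbert function of `k[Xᵢ] ⧸ J`. -/
def HFq (J : Ideal (MvPolynomial ι k)) (m : ℕ) : ℕ := Module.finrank k (qComp k J m)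

/-- The Hilbert function, with `ℤ` argument. -/
def HFZ (J : Ideal (MvPolynomial ι k)) (m : ℤ) : ℕ := Module.finrank k (qCompZ k J m)

/-- A property `P` of tuples `c : τ → k` holds *generically* (i.e. for all choices
in a suitable nonempty Zariski-open subset of the affine space `k^τ`) if there is a
nonzero polynomial `g` such that `P c` holds whenever `g` does not vanish at `c`. -/
def Generic (τ : Type) (P : (τ → k) → Prop) : Prop :=
  ∃ g : MvPolynomial τ k, g ≠ 0 ∧ ∀ c : τ → k, eval c g ≠ 0 → P c

/-- The linear form with coefficient tuple `c`. -/
def linForm (c : ι → k) : MvPolynomial ι k := ∑ i, C (c i) * X i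

/-- The ideal `J` together with the `d` linear forms encoded by `c`. -/
def redIdeal (J : Ideal (MvPolynomial ι k)) {d : ℕ} (c : Fin d × ι → k) :
    Ideal (MvPolynomial ι k) :=
  J ⊔ Ideal.span (Set.range fun j : Fin d => linForm k fun i => c (j, i))

/-- `depth (k[Xᵢ]⧸J) ≥ t` : there is a regular sequence of length `t` consisting of
elements of the graded maximal ideal. -/
def depthGE (J : Ideal (MvPolynomial ι k)) (t : ℕ) : Prop :=
  ∃ rs : List (MvPolynomial ι k), rs.length = t ∧
    (∀ f ∈ rs, f ∈ Ideal.span (Set.range (X : ι → MvPolynomial ι k))) ∧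
    RingTheory.Sequence.IsRegular (MvPolynomial ι k ⧸ J)
      (rs.map (Ideal.Quotient.mk J))

/-- `k[Xᵢ]⧸J` is Cohen–Macaulay of Krull dimension `d`. -/
def isCM (J : Ideal (MvPolynomial ι k)) (d : ℕ) : Prop :=
  ringKrullDim (MvPolynomial ι k ⧸ J) = (d : ℕ) ∧ depthGE k J d

/-- The socle of `k[Xᵢ]⧸J` (the annihilator of the graded maximal ideal). -/
def socle (J : Ideal (MvPolynomial ι k)) : Submodule k (MvPolynomial ι k ⧸ J) :=
  ⨅ i : ι, LinearMap.ker (LinearMap.mulLeft k (Ideal.Quotient.mk J (X i)))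

/-- `k[Xᵢ]⧸J` is Artinian Gorenstein: Artinian with one-dimensional socle. -/
def artGor (J : Ideal (MvPolynomial ι k)) : Prop :=
  IsArtinianRing (MvPolynomial ι k ⧸ J) ∧ Module.finrank k (socle k J) = 1

/-- `k[Xᵢ]⧸J` is Gorenstein of Krull dimension `d`: it is Cohen–Macaulay of
dimension `d` and a general Artinian reduction is Artinian Gorenstein. -/
def isGor (J : Ideal (MvPolynomial ι k)) (d : ℕ) : Prop :=
  isCM k J d ∧ Generic k (Fin d × ι) fun c => artGor k (redIdeal k J c)

/-- Multiplication by `ω` from the degree-`m` component to the degree-`(m+1)`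
component of `k[Xᵢ]⧸J` has maximal rank (is injective or surjective). -/
def mulMaxRank (J : Ideal (MvPolynomial ι k)) (ω : MvPolynomial ι k ⧸ J) (m : ℕ) : Prop :=
  (∀ x ∈ qComp k J m, ω * x = 0 → x = 0) ∨
  (∀ y ∈ qComp k J (m + 1), ∃ x ∈ qComp k J m, ω * x = y)

/-- The Weak Lefschetz Property for the Artinian algebra `k[Xᵢ]⧸J`: for a general
linear form `ω`, multiplication `ω : (⧸J)ₘ → (⧸J)ₘ₊₁` has maximal rank for all `m`. -/
def artWLP (J : Ideal (MvPolynomial ι k)) : Prop :=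
  Generic k ι fun c => ∀ m : ℕ,
    mulMaxRank k J (Ideal.Quotient.mk J (linForm k c)) m

/-- The Weak Lefschetz Property for `k[Xᵢ]⧸J` of Krull dimension `d ≥ 1`:
Cohen–Macaulay, and a general Artinian reduction has the WLP. -/
def hasWLP (J : Ideal (MvPolynomial ι k)) (d : ℕ) : Prop :=
  isCM k J d ∧ Generic k (Fin d × ι) fun c => artWLP k (redIdeal k J c)

/-- The Strong Lefschetz Property for the Artinian algebra `k[Xᵢ]⧸J`. -/
def artSLP (J : Ideal (MvPolynomial ι k)) : Prop :=
  ∃ r : ℕ, qComp k J r ≠ ⊥ ∧ (∀ j : ℕ, r < j → qComp k J j = ⊥) ∧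
    (∀ i ≤ r, HFq k J i = HFq k J (r - i)) ∧
    Generic k ι fun c => ∀ i : ℕ, 2 * i ≤ r →
      (∀ x ∈ qComp k J i,
          Ideal.Quotient.mk J (linForm k c) ^ (r - 2 * i) * x = 0 → x = 0) ∧
      (∀ y ∈ qComp k J (r - i), ∃ x ∈ qComp k J i,
          Ideal.Quotient.mk J (linForm k c) ^ (r - 2 * i) * x = y)

/-- The Strong Lefschetz Property for `k[Xᵢ]⧸J` of Krull dimension `d ≥ 1`. -/
def hasSLP (J : Ideal (MvPolynomial ι k)) (d : ℕ) : Prop :=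
  isCM k J d ∧ Generic k (Fin d × ι) fun c => artSLP k (redIdeal k J c)

/-- `D` is Gorenstein* over `k`: every element of the vertex set is a vertex,
`k[D]` is Gorenstein (of dimension `dim D + 1`), and for every vertex `i` there is a
face `τ` with `τ ∪ {i}` not a face. -/
def gorStar (D : SC n) : Prop :=
  (∀ i : Fin n, {i} ∈ D.faces) ∧
  isGor k (srIdeal k D) (dimP D) ∧
  (∀ i : Fin n, ∃ τ ∈ D.faces, insert i τ ∉ D.faces)

/-! `R[T]` is modelled as the polynomial ring in `n+1` variables, the last
variable playing the role of `T`. -/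

/-- The inclusion `R = k[x₁,…,xₙ] → R[T] = k[x₁,…,xₙ,T]`. -/
def toT : MvPolynomial (Fin n) k →ₐ[k] MvPolynomial (Fin (n + 1)) k :=
  rename Fin.castSucc

/-- The variable `T` of `R[T]`. -/
def Tv (n : ℕ) : MvPolynomial (Fin (n + 1)) k := X (Fin.last n)

/-- Extension of an ideal of `R` to `R[T]`. -/
def extI (J : Ideal (MvPolynomial (Fin n) k)) : Ideal (MvPolynomial (Fin (n + 1)) k) :=
  Ideal.map (toT k) J

/-- The ideal `T·J` of `R[T]`, for an ideal `J` of `R`. -/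
def TmulI (J : Ideal (MvPolynomial (Fin n) k)) : Ideal (MvPolynomial (Fin (n + 1)) k) :=
  Ideal.span ((fun f => Tv k n * toT k f) '' (J : Set (MvPolynomial (Fin n) k)))

/-- `I_L = (I_D : x_σ)`, the Stanley–Reisner ideal of the link of `σ` in `D`
(extended to `R`). -/
def linkIdeal (D : SC n) (σ : Finset (Fin n)) : Ideal (MvPolynomial (Fin n) k) :=
  Submodule.colon (srIdeal k D) (Ideal.span {xFace k σ})

/-- `J_st = (I, x_σ, T·I_L) ⊂ R[T]`, the Stanley–Reisner ideal of the stellar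
subdivision `D_σ`. -/
def Jst (D : SC n) (σ : Finset (Fin n)) : Ideal (MvPolynomial (Fin (n + 1)) k) :=
  extI k (srIdeal k D) ⊔ Ideal.span {toT k (xFace k σ)} ⊔ TmulI k (linkIdeal k D σ)

/-- `I_C = (I, T^{q+1}, T·I_L) ⊂ R[T]`. -/
def IC (D : SC n) (σ : Finset (Fin n)) (q : ℕ) : Ideal (MvPolynomial (Fin (n + 1)) k) :=
  extI k (srIdeal k D) ⊔ Ideal.span {Tv k n ^ (q + 1)} ⊔ TmulI k (linkIdeal k D σ)

/-- `I_G = (I, T^{q+1} - x_σ, T·I_L) ⊂ R[T]`. -/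
def IG (D : SC n) (σ : Finset (Fin n)) (q : ℕ) : Ideal (MvPolynomial (Fin (n + 1)) k) :=
  extI k (srIdeal k D) ⊔ Ideal.span {Tv k n ^ (q + 1) - toT k (xFace k σ)} ⊔
    TmulI k (linkIdeal k D σ)

/-- The ideal of `R[T]` generated by `d` general linear forms of `R`
(involving only the `x`-variables). -/
def xForms {d : ℕ} (c : Fin d × Fin n → k) : Ideal (MvPolynomial (Fin (n + 1)) k) :=
  Ideal.span (Set.range fun j : Fin d => toT k (linForm k fun i => c (j, i)))

/-- Property `M_{q,p₁}` for the Artinian algebra `B = R⧸J_B`: for a general linear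
form `ω`, multiplication by `ω^q : B_{p₁-q} → B_{p₁}` is injective. -/
def propM (JB : Ideal (MvPolynomial (Fin n) k)) (q p₁ : ℕ) : Prop :=
  Generic k (Fin n) fun c => ∀ x ∈ qCompZ k JB ((p₁ : ℤ) - (q : ℤ)),
    Ideal.Quotient.mk JB (linForm k c) ^ q * x = 0 → x = 0


set_option linter.unusedSectionVars false
set_option linter.unusedFintypeInType false
set_option linter.style.haveILetI false

section RegularSequences

variable {S : Type*} [CommRing S]

/-- `y` is a nonzerodivisor modulo `J`. -/
def NZ (J : Ideal S) (y : S) : Prop := ∀ a, y * a ∈ J → a ∈ J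

/-- The list `L` is a weakly regular sequence on `S ⧸ J`. -/
def Reg : Ideal S → List S → Prop
  | _, [] => True
  | J, y :: L => NZ J y ∧ Reg (J ⊔ Ideal.span {y}) L

/-- There is a weakly regular sequence of length `t` on `S ⧸ J` with entries in `m`. -/
def Dep (m : Ideal S) : ℕ → Ideal S → Prop
  | 0, _ => True
  | t + 1, J => ∃ y ∈ m, NZ J y ∧ Dep m t (J ⊔ Ideal.span {y})

/-- `S ⧸ J` has no nonzero element killed by `m`. -/
def SocFree (m J : Ideal S) : Prop := ∀ a, (∀ z ∈ m, z * a ∈ J) → a ∈ J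

lemma mem_sup_span_singleton_iff {J : Ideal S} {y a : S} :
    a ∈ J ⊔ Ideal.span {y} ↔ ∃ b, a - y * b ∈ J := by
  constructor
  · intro h
    obtain ⟨j, hj, z, hz, rfl⟩ := Submodule.mem_sup.1 h
    obtain ⟨b, rfl⟩ := Ideal.mem_span_singleton'.1 hz
    exact ⟨b, by simpa [mul_comm] using hj⟩
  · rintro ⟨b, hb⟩
    have : a = (a - y * b) + y * b := by ring
    rw [this]
    exact Ideal.add_mem _ (Ideal.mem_sup_left hb)
      (Ideal.mem_sup_right (Ideal.mul_mem_right _ _ (Ideal.mem_span_singleton_self y)))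

lemma NZ.swap {J : Ideal S} {x z : S} (hx : NZ J x) (hz : NZ (J ⊔ Ideal.span {x}) z) :
    NZ (J ⊔ Ideal.span {z}) x := by
  intro a ha
  obtain ⟨b, hb⟩ := mem_sup_span_singleton_iff.1 ha
  have hzb : z * b ∈ J ⊔ Ideal.span {x} := by
    refine mem_sup_span_singleton_iff.2 ⟨a, ?_⟩
    have := J.neg_mem hb
    simpa using this
  obtain ⟨c, hc⟩ := mem_sup_span_singleton_iff.1 (hz b hzb)
  refine mem_sup_span_singleton_iff.2 ⟨c, hx _ ?_⟩
  have : x * (a - z * c) = (x * a - z * b) + z * (b - x * c) := by ring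
  rw [this]
  exact J.add_mem hb (J.mul_mem_left _ hc)

lemma NZ.socFree {m J : Ideal S} {y : S} (hy : y ∈ m) (h : NZ J y) : SocFree m J :=
  fun a ha => h a (ha y hy)

lemma Dep.socFree {m J : Ideal S} {t : ℕ} (h : Dep m (t + 1) J) : SocFree m J := by
  obtain ⟨y, hy, h1, -⟩ := h
  exact h1.socFree hy

lemma SocFree.exchange {m J : Ideal S} {x y : S} (hxm : x ∈ m) (hx : NZ J x) (hy : NZ J y)
    (h : SocFree m (J ⊔ Ideal.span {x})) : SocFree m (J ⊔ Ideal.span {y}) := by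
  intro a ha
  obtain ⟨b, hb⟩ := mem_sup_span_singleton_iff.1 (ha x hxm)
  have hb' : b ∈ J ⊔ Ideal.span {x} := by
    refine h b fun z hz => ?_
    obtain ⟨c, hc⟩ := mem_sup_span_singleton_iff.1 (ha z hz)
    refine mem_sup_span_singleton_iff.2 ⟨c, hy _ ?_⟩
    have : y * (z * b - x * c) = x * (z * a - y * c) - z * (x * a - y * b) := by ring
    rw [this]
    exact J.sub_mem (J.mul_mem_left _ hc) (J.mul_mem_left _ hb)
  obtain ⟨c, hc⟩ := mem_sup_span_singleton_iff.1 hb'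
  refine mem_sup_span_singleton_iff.2 ⟨c, hx _ ?_⟩
  have : x * (a - y * c) = (x * a - y * b) + y * (b - x * c) := by ring
  rw [this]
  exact J.add_mem hb (J.mul_mem_left _ hc)

/-- Depth drops by exactly one modulo any nonzerodivisor in `m`, provided that finitely many
ideals without socle admit a common nonzerodivisor in `m`. -/
lemma Dep.exchange {m : Ideal S}
    (avoid : ∀ J₁ J₂ J₃ : Ideal S, SocFree m J₁ → SocFree m J₂ → SocFree m J₃ →
      ∃ z ∈ m, NZ J₁ z ∧ NZ J₂ z ∧ NZ J₃ z) (t : ℕ) :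
    ∀ (J : Ideal S) (y : S), y ∈ m → NZ J y → Dep m (t + 1) J →
      Dep m t (J ⊔ Ideal.span {y}) := by
  induction t with
  | zero => intros; trivial
  | succ t ih =>
    rintro J y hym hy ⟨x, hxm, hx, hd⟩
    obtain ⟨z, hzm, hz, hzx, hzy⟩ := avoid J (J ⊔ Ideal.span {x}) (J ⊔ Ideal.span {y})
      (hx.socFree hxm) hd.socFree (hd.socFree.exchange hxm hx hy)
    have h1 : Dep m (t + 1) (J ⊔ Ideal.span {z}) := by
      refine ⟨x, hxm, hx.swap hzx, ?_⟩
      have := ih _ z hzm hzx hd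
      rwa [sup_right_comm] at this
    refine ⟨z, hzm, hzy, ?_⟩
    have := ih _ y hym (hy.swap hzy) h1
    rwa [sup_right_comm] at this

lemma Reg.of_isWeaklyRegular (L : List S) :
    ∀ J : Ideal S, RingTheory.Sequence.IsWeaklyRegular (S ⧸ J) L → Reg J L := by
  induction L with
  | nil => intros; trivial
  | cons y L ih =>
    intro J h
    rw [RingTheory.Sequence.isWeaklyRegular_cons_iff] at h
    refine ⟨fun a ha => ?_, ih _ ?_⟩
    · rw [← Ideal.Quotient.eq_zero_iff_mem]
      exact h.1.right_eq_zero_of_smul (Ideal.Quotient.eq_zero_iff_mem.2 ha)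
    · have e : QuotSMulTop y (S ⧸ J) ≃ₗ[S] (S ⧸ (J ⊔ Ideal.span {y})) := by
        refine (Submodule.quotEquivOfEq _ _ ?_).trans
          (Submodule.quotientQuotientEquivQuotientSup J (Ideal.span {y}))
        ext a
        obtain ⟨a, rfl⟩ := Submodule.mkQ_surjective J a
        rw [Submodule.mem_smul_pointwise_iff_exists, Submodule.mem_map]
        constructor
        · rintro ⟨b, -, hb⟩
          obtain ⟨b, rfl⟩ := Submodule.mkQ_surjective J b
          exact ⟨y * b, Ideal.mul_mem_right _ _ (Ideal.mem_span_singleton_self y), hb⟩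
        · rintro ⟨b, hb, hb'⟩
          obtain ⟨c, rfl⟩ := Ideal.mem_span_singleton'.1 hb
          refine ⟨J.mkQ c, trivial, ?_⟩
          rw [← hb', mul_comm]
          rfl
      exact (e.isWeaklyRegular_congr L).1 h.2

lemma Reg.dep {m : Ideal S} (L : List S) (hL : ∀ y ∈ L, y ∈ m) :
    ∀ J : Ideal S, Reg J L → Dep m L.length J := by
  induction L with
  | nil => intros; trivial
  | cons y L ih =>
    intro J h
    exact ⟨y, hL y (by simp), h.1, ih (fun z hz => hL z (by simp [hz])) _ h.2⟩

end RegularSequences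

section GenericForms

/-- The ideal generated by the variables. -/
def irr (ι : Type) : Ideal (MvPolynomial ι k) := Ideal.span (Set.range X)

/-- `linForm` as a linear map in the coefficients. -/
def linFormL : (ι → k) →ₗ[k] MvPolynomial ι k where
  toFun := linForm k
  map_add' c c' := by simp [linForm, add_mul, Finset.sum_add_distrib]
  map_smul' r c := by simp [linForm, Finset.smul_sum, smul_eq_C_mul, mul_assoc]

lemma linForm_add (c c' : ι → k) : linForm k (c + c') = linForm k c + linForm k c' :=
  (linFormL k).map_add c c'

lemma linForm_smul (r : k) (c : ι → k) : linForm k (r • c) = r • linForm k c :=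
  (linFormL k).map_smul r c

variable {k}

lemma linForm_single [DecidableEq ι] (i : ι) : linForm k (Pi.single i 1) = X i := by
  rw [linForm, Finset.sum_eq_single i]
  · simp
  · intro j _ hj
    simp [hj]
  · simp

lemma linForm_mem_irr (c : ι → k) : linForm k c ∈ irr k ι :=
  Ideal.sum_mem _ fun i _ => Ideal.mul_mem_left _ _ (Ideal.subset_span ⟨i, rfl⟩)

lemma eval_bind₁_eq {τ τ' : Type} (c : τ → k) (F : τ' → MvPolynomial τ k)
    (g : MvPolynomial τ' k) : eval c (bind₁ F g) = eval (fun i => eval c (F i)) g := by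
  rw [← aeval_eq_eval, ← aeval_eq_eval]
  exact aeval_bind₁ _ _ _

lemma ne_zero_of_eval_ne_zero {τ : Type} {g : MvPolynomial τ k} {c : τ → k}
    (h : eval c g ≠ 0) : g ≠ 0 := by
  rintro rfl
  simp at h

lemma exists_eval_ne_zero [Infinite k] {τ : Type} {g : MvPolynomial τ k} (h : g ≠ 0) :
    ∃ c : τ → k, eval c g ≠ 0 := by
  by_contra! H
  exact h (MvPolynomial.funext fun c => by simp [H c])

lemma generic_NZ_linForm (J : Ideal (MvPolynomial ι k)) (h : SocFree (irr k ι) J) :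
    Generic k ι fun c => NZ J (linForm k c) := by
  classical
  let A := MvPolynomial ι k
  have hfin : (associatedPrimes A (A ⧸ J)).Finite := associatedPrimes.finite A (A ⧸ J)
  have key : ∀ P ∈ associatedPrimes A (A ⧸ J), ∃ g : MvPolynomial ι k, g ≠ 0 ∧
      ∀ c, eval c g ≠ 0 → linForm k c ∉ P := by
    intro P hP
    obtain ⟨hprime, x, hx⟩ := Submodule.isAssociatedPrime_iff.1 hP
    have hi : ∃ i : ι, X i ∉ P := by
      by_contra! H
      obtain ⟨a, rfl⟩ := Ideal.Quotient.mk_surjective x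
      have ha : a ∈ J := by
        refine h a fun z hz => ?_
        have hzP : z ∈ P := (Ideal.span_le.2 (by rintro _ ⟨i, rfl⟩; exact H i) : irr k ι ≤ P) hz
        rw [hx, Submodule.mem_colon_singleton, Submodule.mem_bot] at hzP
        exact Ideal.Quotient.eq_zero_iff_mem.1 hzP
      apply hprime.ne_top
      rw [hx, Ideal.eq_top_iff_one, Submodule.mem_colon_singleton,
        Ideal.Quotient.eq_zero_iff_mem.2 ha]
      simp
    obtain ⟨i, hi⟩ := hi
    let L : (ι → k) →ₗ[k] A ⧸ P := (Ideal.Quotient.mkₐ k P).toLinearMap ∘ₗ linFormL k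
    have hL : L (Pi.single i 1) ≠ 0 := by
      intro h0
      apply hi
      have : L (Pi.single i 1) = Ideal.Quotient.mk P (X i) :=
        congrArg (Ideal.Quotient.mk P) (linForm_single i)
      rw [this] at h0
      exact Ideal.Quotient.eq_zero_iff_mem.1 h0
    obtain ⟨f, hf⟩ : ∃ f : Module.Dual k (A ⧸ P), f (L (Pi.single i 1)) ≠ 0 := by
      by_contra! H
      exact hL ((Module.forall_dual_apply_eq_zero_iff k _).1 H)
    have hev : ∀ c : ι → k, eval c (∑ j, C (f (L (Pi.single j 1))) * X j) = f (L c) := by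
      intro c
      conv_rhs => rw [pi_eq_sum_univ' c]
      simp [mul_comm]
    refine ⟨∑ j, C (f (L (Pi.single j 1))) * X j, ?_, ?_⟩
    · apply ne_zero_of_eval_ne_zero (c := Pi.single i 1)
      rwa [hev]
    · intro c hc hcP
      rw [hev] at hc
      apply hc
      have : L c = 0 := Ideal.Quotient.eq_zero_iff_mem.2 hcP
      rw [this, map_zero]
  choose! G hG0 hG using key
  refine ⟨∏ P ∈ hfin.toFinset, G P, ?_, ?_⟩
  · exact Finset.prod_ne_zero_iff.2 fun P hP => hG0 P (hfin.mem_toFinset.1 hP)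
  · intro c hc
    rw [map_prod, Finset.prod_ne_zero_iff] at hc
    have : linForm k c ∉ ⋃ P ∈ associatedPrimes A (A ⧸ J), (P : Set A) := by
      simp only [Set.mem_iUnion, not_exists]
      exact fun P hP => hG P hP c (hc P (hfin.mem_toFinset.2 hP))
    rw [biUnion_associatedPrimes_eq_compl_regular, Set.notMem_compl_iff] at this
    intro a ha
    have h2 : IsSMulRegular (A ⧸ J) (linForm k c) := this
    exact Ideal.Quotient.eq_zero_iff_mem.1
      (h2.right_eq_zero_of_smul (x := Ideal.Quotient.mk J a) (Ideal.Quotient.eq_zero_iff_mem.2 ha))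

lemma exists_common_NZ [Infinite k] (J₁ J₂ J₃ : Ideal (MvPolynomial ι k))
    (h₁ : SocFree (irr k ι) J₁) (h₂ : SocFree (irr k ι) J₂) (h₃ : SocFree (irr k ι) J₃) :
    ∃ z ∈ irr k ι, NZ J₁ z ∧ NZ J₂ z ∧ NZ J₃ z := by
  obtain ⟨g₁, n₁, H₁⟩ := generic_NZ_linForm J₁ h₁
  obtain ⟨g₂, n₂, H₂⟩ := generic_NZ_linForm J₂ h₂
  obtain ⟨g₃, n₃, H₃⟩ := generic_NZ_linForm J₃ h₃
  obtain ⟨c, hc⟩ := exists_eval_ne_zero (mul_ne_zero (mul_ne_zero n₁ n₂) n₃)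
  simp only [map_mul, mul_ne_zero_iff] at hc
  exact ⟨linForm k c, linForm_mem_irr c, H₁ c hc.1.1, H₂ c hc.1.2, H₃ c hc.2⟩

/-- The list of linear forms encoded by `c`. -/
def formList {d : ℕ} (c : Fin d × ι → k) : List (MvPolynomial ι k) :=
  List.ofFn fun j : Fin d => linForm k fun i => c (j, i)

lemma exists_reg_formList [Infinite k] (t : ℕ) : ∀ (J : Ideal (MvPolynomial ι k)),
    Dep (irr k ι) t J → ∀ g : MvPolynomial (Fin t × ι) k, g ≠ 0 →
      ∃ c, eval c g ≠ 0 ∧ Reg J (formList c) := by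
  induction t with
  | zero =>
    intro J _ g hg
    obtain ⟨c, hc⟩ := exists_eval_ne_zero hg
    exact ⟨c, hc, by simp [formList, Reg]⟩
  | succ t ih =>
    intro J hJ g hg
    obtain ⟨c, hc⟩ := exists_eval_ne_zero hg
    let cons : (ι → k) → (Fin t × ι → k) → Fin (t + 1) × ι → k := fun r c' p =>
      Fin.cases (motive := fun _ => k) (r p.2) (fun j => c' (j, p.2)) p.1
    have hcons : cons (fun i => c (0, i)) (fun p => c (p.1.succ, p.2)) = c := by
      funext ⟨j, i⟩
      refine Fin.cases ?_ (fun j => ?_) j <;> simp [cons]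
    obtain ⟨g₁, hg₁⟩ : ∃ g₁ : (Fin t × ι → k) → MvPolynomial ι k,
        ∀ r c', eval r (g₁ c') = eval (cons r c') g := by
      refine ⟨fun c' => bind₁ (fun p => Fin.cases (motive := fun _ => MvPolynomial ι k) (X p.2)
        (fun j => C (c' (j, p.2))) p.1) g, fun r c' => ?_⟩
      rw [eval_bind₁_eq]
      congr 1
      congr 1
      funext ⟨j, i⟩
      refine Fin.cases ?_ (fun j => ?_) j <;> simp [cons]
    obtain ⟨g₂, hg₂⟩ : ∃ g₂ : (ι → k) → MvPolynomial (Fin t × ι) k,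
        ∀ r c', eval c' (g₂ r) = eval (cons r c') g := by
      refine ⟨fun r => bind₁ (fun p => Fin.cases (motive := fun _ => MvPolynomial (Fin t × ι) k) (C (r p.2))
        (fun j => X (j, p.2)) p.1) g, fun r c' => ?_⟩
      rw [eval_bind₁_eq]
      congr 1
      congr 1
      funext ⟨j, i⟩
      refine Fin.cases ?_ (fun j => ?_) j <;> simp [cons]
    obtain ⟨gJ, nJ, HJ⟩ := generic_NZ_linForm J hJ.socFree
    have n₁ : g₁ (fun p => c (p.1.succ, p.2)) ≠ 0 := by
      apply ne_zero_of_eval_ne_zero (c := fun i => c (0, i))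
      rwa [hg₁, hcons]
    obtain ⟨r, hr⟩ := exists_eval_ne_zero (mul_ne_zero n₁ nJ)
    rw [map_mul, mul_ne_zero_iff, hg₁] at hr
    have hr₁ : eval (fun p => c (p.1.succ, p.2)) (g₂ r) ≠ 0 := by
      rw [hg₂]
      exact hr.1
    have hreg := HJ r hr.2
    obtain ⟨c', hc', hc''⟩ := ih _
      (hJ.exchange exists_common_NZ t J _ (linForm_mem_irr r) hreg) (g₂ r)
      (ne_zero_of_eval_ne_zero hr₁)
    refine ⟨cons r c', by rwa [← hg₂], ?_⟩
    rw [formList, List.ofFn_succ]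
    exact ⟨hreg, hc''⟩

end GenericForms

section Homogeneity

variable {k}

/-- The ideal `J` contains the homogeneous components of its elements. -/
def HomI (J : Ideal (MvPolynomial ι k)) : Prop :=
  ∀ f ∈ J, ∀ m, homogeneousComponent m f ∈ J

lemma homogeneousComponent_mul_of_isHomogeneous {g : MvPolynomial ι k} {e : ℕ}
    (hg : g.IsHomogeneous e) (a : MvPolynomial ι k) (m : ℕ) :
    homogeneousComponent m (g * a) =
      if e ≤ m then g * homogeneousComponent (m - e) a else 0 := by
  have h : ∀ b : MvPolynomial ι k, ∀ r, b.IsHomogeneous r → homogeneousComponent m (g * b) =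
      if e ≤ m then g * homogeneousComponent (m - e) b else 0 := by
    intro b r hb
    rw [homogeneousComponent_of_mem ((mem_homogeneousSubmodule _ _).2 (hg.mul hb)),
      homogeneousComponent_of_mem ((mem_homogeneousSubmodule _ _).2 hb)]
    split_ifs <;> first | rfl | omega | simp
  conv_lhs => rw [← sum_homogeneousComponent a]
  conv_rhs => rw [← sum_homogeneousComponent a]
  rw [Finset.mul_sum, map_sum, map_sum,
    Finset.sum_congr rfl fun r _ => h _ r (homogeneousComponent_isHomogeneous r a)]
  split_ifs
  · rw [Finset.mul_sum]
  · simp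

lemma homogeneousComponent_succ_mul {g : MvPolynomial ι k} (hg : g.IsHomogeneous 1)
    (a : MvPolynomial ι k) (m : ℕ) :
    homogeneousComponent (m + 1) (g * a) = g * homogeneousComponent m a := by
  simp [homogeneousComponent_mul_of_isHomogeneous hg]

lemma homogeneousComponent_zero_mul {g : MvPolynomial ι k} (hg : g.IsHomogeneous 1)
    (a : MvPolynomial ι k) : homogeneousComponent 0 (g * a) = 0 := by
  simp [homogeneousComponent_mul_of_isHomogeneous hg]

lemma mem_of_homogeneousComponent_mem {J : Ideal (MvPolynomial ι k)} {a : MvPolynomial ι k}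
    (h : ∀ m, homogeneousComponent m a ∈ J) : a ∈ J := by
  rw [← sum_homogeneousComponent a]
  exact J.sum_mem fun m _ => h m

lemma isHomogeneous_linForm (c : ι → k) : (linForm k c).IsHomogeneous 1 :=
  IsHomogeneous.sum _ _ _ fun _ _ => isHomogeneous_C_mul_X _ _

lemma HomI.sup {J K : Ideal (MvPolynomial ι k)} (hJ : HomI J) (hK : HomI K) : HomI (J ⊔ K) := by
  intro f hf m
  obtain ⟨a, ha, b, hb, rfl⟩ := Submodule.mem_sup.1 hf
  rw [map_add]
  exact Ideal.add_mem _ (Ideal.mem_sup_left (hJ a ha m)) (Ideal.mem_sup_right (hK b hb m))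

attribute [local instance] MvPolynomial.gradedAlgebra in
lemma HomI.span {S : Set (MvPolynomial ι k)} (h : ∀ f ∈ S, ∃ m, f.IsHomogeneous m) :
    HomI (Ideal.span S) := by
  intro f hf m
  refine homogeneousComponent_mem_of_mem (Ideal.homogeneous_span _ _ ?_) hf m
  intro x hx
  obtain ⟨m, hm⟩ := h x hx
  exact ⟨m, hm⟩

lemma HomI.sup_singleton {J : Ideal (MvPolynomial ι k)} (hJ : HomI J) {x : MvPolynomial ι k}
    (hx : x.IsHomogeneous 1) : HomI (J ⊔ Ideal.span {x}) :=
  hJ.sup (HomI.span fun f hf => ⟨1, by rwa [Set.mem_singleton_iff.1 hf]⟩)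

lemma HomI.NZ_swap {J : Ideal (MvPolynomial ι k)} (hJ : HomI J) {x y : MvPolynomial ι k}
    (hx1 : x.IsHomogeneous 1) (hy1 : y.IsHomogeneous 1) (hx : NZ J x)
    (hy : NZ (J ⊔ Ideal.span {x}) y) : NZ J y := by
  have key : ∀ m, ∀ a : MvPolynomial ι k, a.IsHomogeneous m → y * a ∈ J → a ∈ J := by
    intro m
    induction m with
    | zero =>
      intro a ha hya
      obtain ⟨b, hb⟩ := mem_sup_span_singleton_iff.1 (hy a (Ideal.mem_sup_left hya))
      have := hJ _ hb 0
      rwa [map_sub, homogeneousComponent_zero_mul hx1, sub_zero,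
        homogeneousComponent_eq_self ha] at this
    | succ m ih =>
      intro a ha hya
      obtain ⟨b, hb⟩ := mem_sup_span_singleton_iff.1 (hy a (Ideal.mem_sup_left hya))
      have h1 := hJ _ hb (m + 1)
      rw [map_sub, homogeneousComponent_succ_mul hx1, homogeneousComponent_eq_self ha] at h1
      have h2 : homogeneousComponent m b ∈ J := by
        refine ih _ (homogeneousComponent_isHomogeneous _ _) (hx _ ?_)
        have : x * (y * homogeneousComponent m b) =
            y * a - y * (a - x * homogeneousComponent m b) := by ring
        rw [this]
        exact J.sub_mem hya (J.mul_mem_left _ h1)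
      have : a = (a - x * homogeneousComponent m b) + x * homogeneousComponent m b := by ring
      rw [this]
      exact J.add_mem h1 (J.mul_mem_left _ h2)
  intro a ha
  refine mem_of_homogeneousComponent_mem fun m => key m _ (homogeneousComponent_isHomogeneous _ _) ?_
  rw [← homogeneousComponent_succ_mul hy1]
  exact hJ _ ha _

lemma HomI.reg_rotate (L : List (MvPolynomial ι k)) : ∀ {J : Ideal (MvPolynomial ι k)}, HomI J →
    ∀ {x : MvPolynomial ι k}, x.IsHomogeneous 1 → (∀ y ∈ L, y.IsHomogeneous 1) →
      Reg J (x :: L) → Reg J (L ++ [x]) := by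
  induction L with
  | nil => intro J _ x _ _ h; exact h
  | cons y L ih =>
    intro J hJ x hx1 hL h
    have hy1 : y.IsHomogeneous 1 := hL y (by simp)
    obtain ⟨hx, hy, h'⟩ := h
    refine ⟨hJ.NZ_swap hx1 hy1 hx hy, ?_⟩
    refine ih (hJ.sup_singleton hy1) hx1 (fun z hz => hL z (by simp [hz])) ⟨hx.swap hy, ?_⟩
    rwa [sup_right_comm]

end Homogeneity

section RegularLists

variable {S : Type*} [CommRing S]

lemma Reg.append_singleton (L : List S) (x : S) : ∀ {J : Ideal S}, Reg J (L ++ [x]) →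
    Reg J L ∧ NZ (J ⊔ Ideal.ofList L) x := by
  induction L with
  | nil => intro J h; exact ⟨trivial, by simpa using h.1⟩
  | cons y L ih =>
    intro J h
    obtain ⟨h1, h2⟩ := ih h.2
    exact ⟨⟨h.1, h1⟩, by rwa [Ideal.ofList_cons, ← sup_assoc]⟩

lemma sup_span_singleton_sub {J : Ideal S} {x : S} (hx : x ∈ J) (y a : S) :
    J ⊔ Ideal.span {y - a * x} = J ⊔ Ideal.span {y} := by
  have h : a * x ∈ J := J.mul_mem_left _ hx
  ext z
  rw [mem_sup_span_singleton_iff, mem_sup_span_singleton_iff]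
  refine exists_congr fun b => ?_
  have : z - (y - a * x) * b = (z - y * b) + (a * x) * b := by ring
  rw [this]
  exact (J.add_mem_iff_left (J.mul_mem_right _ h))

lemma Reg.map_sub (x : S) (a : S → S) (L : List S) : ∀ {J : Ideal S}, x ∈ J → Reg J L →
    Reg J (L.map fun y => y - a y * x) := by
  induction L with
  | nil => intros; trivial
  | cons y L ih =>
    intro J hx h
    refine ⟨fun z hz => h.1 z ?_, ?_⟩
    · have : y * z = (y - a y * x) * z + x * (a y * z) := by ring
      rw [this]
      exact J.add_mem hz (J.mul_mem_right _ hx)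
    · rw [sup_span_singleton_sub hx]
      exact ih (Ideal.mem_sup_left hx) h.2

lemma sup_ofList_map_sub (x : S) (a : S → S) (L : List S) : ∀ {J : Ideal S}, x ∈ J →
    J ⊔ Ideal.ofList (L.map fun y => y - a y * x) = J ⊔ Ideal.ofList L := by
  induction L with
  | nil => intros; rfl
  | cons y L ih =>
    intro J hx
    rw [List.map_cons, Ideal.ofList_cons, Ideal.ofList_cons, ← sup_assoc, ← sup_assoc,
      sup_span_singleton_sub hx, ih (Ideal.mem_sup_left hx)]

end RegularLists

section Hilbert

variable {k}

lemma mem_qComp {J : Ideal (MvPolynomial ι k)} {m : ℕ} {x : MvPolynomial ι k ⧸ J} :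
    x ∈ qComp k J m ↔ ∃ a : MvPolynomial ι k, a.IsHomogeneous m ∧ Ideal.Quotient.mk J a = x :=
  Iff.rfl

lemma mk_mem_qComp {J : Ideal (MvPolynomial ι k)} {m : ℕ} {a : MvPolynomial ι k}
    (ha : a.IsHomogeneous m) : Ideal.Quotient.mk J a ∈ qComp k J m :=
  mem_qComp.2 ⟨a, ha, rfl⟩

instance finite_homogeneousSubmodule (m : ℕ) : FiniteDimensional k (homogeneousSubmodule ι k m) :=
  Module.Finite.iff_fg.2 (homogeneousSubmodule_fg ι k m)

instance finite_qComp (J : Ideal (MvPolynomial ι k)) (m : ℕ) :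
    FiniteDimensional k (qComp k J m) := by
  unfold qComp
  infer_instance

/-- The canonical projection between quotients, as a `k`-linear map. -/
def projL {J K : Ideal (MvPolynomial ι k)} (h : J ≤ K) :
    (MvPolynomial ι k ⧸ J) →ₗ[k] (MvPolynomial ι k ⧸ K) :=
  (Ideal.Quotient.factorₐ k h).toLinearMap

lemma map_projL_qComp {J K : Ideal (MvPolynomial ι k)} (h : J ≤ K) (m : ℕ) :
    (qComp k J m).map (projL h) = qComp k K m := by
  rw [qComp, qComp, ← Submodule.map_comp]
  rfl

lemma finrank_map_add_finrank_inf_ker {V W : Type*} [AddCommGroup V] [Module k V]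
    [AddCommGroup W] [Module k W] (f : V →ₗ[k] W) (U : Submodule k V) [FiniteDimensional k U] :
    Module.finrank k (U.map f) + Module.finrank k (U ⊓ LinearMap.ker f : Submodule k V) =
      Module.finrank k U := by
  rw [← LinearMap.finrank_range_add_finrank_ker (f.domRestrict U), LinearMap.range_domRestrict,
    LinearMap.ker_domRestrict, ← Submodule.map_comap_subtype, Submodule.finrank_map_subtype_eq]

lemma HFq_eq_zero_iff {J : Ideal (MvPolynomial ι k)} {m : ℕ} :
    HFq k J m = 0 ↔ ∀ a : MvPolynomial ι k, a.IsHomogeneous m → a ∈ J := by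
  rw [HFq, Submodule.finrank_eq_zero, eq_bot_iff]
  constructor
  · intro h a ha
    exact Ideal.Quotient.eq_zero_iff_mem.1 (h (mk_mem_qComp ha))
  · rintro h _ ⟨a, ha, rfl⟩
    exact Ideal.Quotient.eq_zero_iff_mem.2 (h a ha)

lemma eq_of_HFq_eq {J K : Ideal (MvPolynomial ι k)} (h : J ≤ K) (hK : HomI K)
    (H : ∀ m, HFq k J m = HFq k K m) : J = K := by
  refine le_antisymm h fun f hf => mem_of_homogeneousComponent_mem fun m => ?_
  have := finrank_map_add_finrank_inf_ker (projL h) (qComp k J m)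
  rw [map_projL_qComp] at this
  have h0 : Module.finrank k (qComp k J m ⊓ LinearMap.ker (projL h) : Submodule k _) = 0 := by
    have := H m
    unfold HFq at this
    omega
  have : FiniteDimensional k (qComp k J m ⊓ LinearMap.ker (projL h) : Submodule k _) :=
    Submodule.finiteDimensional_inf_left _ _
  rw [Submodule.finrank_eq_zero, eq_bot_iff] at h0
  refine Ideal.Quotient.eq_zero_iff_mem.1 (h0 ⟨mk_mem_qComp
    (homogeneousComponent_isHomogeneous m f), ?_⟩)
  exact Ideal.Quotient.eq_zero_iff_mem.2 (hK f hf m)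

/-- The Hilbert series. -/
def Hs (J : Ideal (MvPolynomial ι k)) : PowerSeries ℤ := PowerSeries.mk fun m => (HFq k J m : ℤ)

lemma mul_mk_injective {J : Ideal (MvPolynomial ι k)} {x : MvPolynomial ι k} (hx : NZ J x) :
    Function.Injective (LinearMap.mulLeft k (Ideal.Quotient.mk J x)) := by
  rw [← LinearMap.ker_eq_bot, eq_bot_iff]
  intro a ha
  obtain ⟨a, rfl⟩ := Ideal.Quotient.mk_surjective a
  exact Ideal.Quotient.eq_zero_iff_mem.2 (hx a (Ideal.Quotient.eq_zero_iff_mem.1 ha))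

lemma HFq_sup_singleton_succ {J : Ideal (MvPolynomial ι k)} (hJ : HomI J) {x : MvPolynomial ι k}
    (hx1 : x.IsHomogeneous 1) (hx : NZ J x) (m : ℕ) :
    HFq k (J ⊔ Ideal.span {x}) (m + 1) + HFq k J m = HFq k J (m + 1) := by
  have hle : J ≤ J ⊔ Ideal.span {x} := le_sup_left
  have := finrank_map_add_finrank_inf_ker (projL hle) (qComp k J (m + 1))
  rw [map_projL_qComp] at this
  have h2 : qComp k J (m + 1) ⊓ LinearMap.ker (projL hle) =
      (qComp k J m).map (LinearMap.mulLeft k (Ideal.Quotient.mk J x)) := by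
    ext y
    constructor
    · rintro ⟨⟨a, ha, rfl⟩, hy⟩
      have hy : a ∈ J ⊔ Ideal.span {x} := Ideal.Quotient.eq_zero_iff_mem.1 hy
      obtain ⟨b, hb⟩ := mem_sup_span_singleton_iff.1 hy
      have h1 := hJ _ hb (m + 1)
      rw [_root_.map_sub, homogeneousComponent_succ_mul hx1, homogeneousComponent_eq_self ha] at h1
      exact ⟨_, mk_mem_qComp (homogeneousComponent_isHomogeneous m b),
        ((Ideal.Quotient.eq (I := J)).2 h1).symm⟩
    · rintro ⟨_, ⟨a, ha, rfl⟩, rfl⟩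
      refine ⟨⟨x * a, ?_, rfl⟩, Ideal.Quotient.eq_zero_iff_mem.2
        (Ideal.mem_sup_right (Ideal.mul_mem_right _ _ (Ideal.mem_span_singleton_self x)))⟩
      rw [add_comm]
      exact hx1.mul ha
  rw [h2, LinearEquiv.finrank_eq (Submodule.equivMapOfInjective _ (mul_mk_injective hx) _).symm]
    at this
  exact this

lemma HFq_sup_singleton_zero {J : Ideal (MvPolynomial ι k)} (hJ : HomI J) {x : MvPolynomial ι k}
    (hx1 : x.IsHomogeneous 1) : HFq k (J ⊔ Ideal.span {x}) 0 = HFq k J 0 := by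
  have hle : J ≤ J ⊔ Ideal.span {x} := le_sup_left
  have := finrank_map_add_finrank_inf_ker (projL hle) (qComp k J 0)
  rw [map_projL_qComp] at this
  have h2 : qComp k J 0 ⊓ LinearMap.ker (projL hle) = ⊥ := by
    rw [eq_bot_iff]
    rintro _ ⟨⟨a, ha, rfl⟩, hy⟩
    have hy : a ∈ J ⊔ Ideal.span {x} := Ideal.Quotient.eq_zero_iff_mem.1 hy
    obtain ⟨b, hb⟩ := mem_sup_span_singleton_iff.1 hy
    have h1 := hJ _ hb 0
    rw [_root_.map_sub, homogeneousComponent_zero_mul hx1, homogeneousComponent_eq_self ha,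
      sub_zero] at h1
    exact Ideal.Quotient.eq_zero_iff_mem.2 h1
  rw [h2, finrank_bot] at this
  exact this

lemma Hs_sup_singleton {J : Ideal (MvPolynomial ι k)} (hJ : HomI J) {x : MvPolynomial ι k}
    (hx1 : x.IsHomogeneous 1) (hx : NZ J x) :
    Hs (J ⊔ Ideal.span {x}) = (1 - PowerSeries.X) * Hs J := by
  ext m
  rw [sub_mul, one_mul, _root_.map_sub]
  cases m with
  | zero => simp [Hs, HFq_sup_singleton_zero hJ hx1]
  | succ m =>
    rw [PowerSeries.coeff_succ_X_mul]
    simp only [Hs, PowerSeries.coeff_mk]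
    have := HFq_sup_singleton_succ hJ hx1 hx m
    omega

lemma Hs_sup_ofList (L : List (MvPolynomial ι k)) : ∀ {J : Ideal (MvPolynomial ι k)}, HomI J →
    (∀ y ∈ L, y.IsHomogeneous 1) → Reg J L →
      Hs (J ⊔ Ideal.ofList L) = (1 - PowerSeries.X) ^ L.length * Hs J := by
  induction L with
  | nil => intro J _ _ _; simp
  | cons y L ih =>
    intro J hJ hL h
    have hy1 : y.IsHomogeneous 1 := hL y (by simp)
    rw [Ideal.ofList_cons, ← sup_assoc, ih (hJ.sup_singleton hy1)
      (fun z hz => hL z (by simp [hz])) h.2, Hs_sup_singleton hJ hy1 h.1, List.length_cons,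
      pow_succ, mul_assoc]

end Hilbert

section MonomialIdeals

/-- The exponent vector of the squarefree monomial supported on `s`. -/
def chi (s : Finset (Fin n)) : Fin n →₀ ℕ := ∑ i ∈ s, Finsupp.single i 1

lemma chi_apply (s : Finset (Fin n)) (j : Fin n) : chi s j = if j ∈ s then 1 else 0 := by
  simp [chi, Finsupp.finsetSum_apply, Finsupp.single_apply]

lemma chi_le_iff (s : Finset (Fin n)) (a : Fin n →₀ ℕ) : chi s ≤ a ↔ s ⊆ a.support := by
  constructor
  · intro h j hj
    have := h j
    rw [chi_apply, if_pos hj] at this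
    exact Finsupp.mem_support_iff.2 (by omega)
  · intro h j
    rw [chi_apply]
    split_ifs with hj
    · have := Finsupp.mem_support_iff.1 (h hj)
      omega
    · exact Nat.zero_le _

lemma support_chi_add (s : Finset (Fin n)) (a : Fin n →₀ ℕ) :
    (chi s + a).support = a.support ∪ s := by
  ext j
  simp only [Finsupp.mem_support_iff, Finsupp.add_apply, chi_apply, Finset.mem_union]
  split_ifs <;> simp_all

variable {k}

lemma prod_X_eq (s : Finset (Fin n)) :
    (∏ i ∈ s, X i : MvPolynomial (Fin n) k) = monomial (chi s) 1 := by
  rw [chi, monomial_sum_one]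
  rfl

lemma mem_srIdeal {D : SC n} {f : MvPolynomial (Fin n) k} :
    f ∈ srIdeal k D ↔ ∀ a ∈ f.support, a.support ∉ D.faces := by
  have : {p : MvPolynomial (Fin n) k | ∃ s : Finset (Fin n), s ∉ D.faces ∧ p = ∏ i ∈ s, X i} =
      (fun a => monomial a (1 : k)) '' {a | ∃ s, s ∉ D.faces ∧ a = chi s} := by
    ext p
    constructor
    · rintro ⟨s, hs, rfl⟩
      exact ⟨_, ⟨s, hs, rfl⟩, (prod_X_eq s).symm⟩
    · rintro ⟨_, ⟨s, hs, rfl⟩, rfl⟩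
      exact ⟨s, hs, (prod_X_eq s).symm⟩
  rw [srIdeal, this, mem_ideal_span_monomial_image]
  refine forall₂_congr fun a _ => ⟨?_, ?_⟩
  · rintro ⟨_, ⟨s, hs, rfl⟩, hle⟩ hD
    exact hs (D.down_closed _ hD _ ((chi_le_iff s a).1 hle))
  · intro h
    exact ⟨_, ⟨_, h, rfl⟩, (chi_le_iff _ a).2 le_rfl⟩

lemma mem_linkIdeal_iff_mul {D : SC n} {σ : Finset (Fin n)} {f : MvPolynomial (Fin n) k} :
    f ∈ linkIdeal k D σ ↔ xFace k σ * f ∈ srIdeal k D := by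
  rw [linkIdeal, Submodule.mem_colon]
  constructor
  · intro h
    have := h _ (Ideal.mem_span_singleton_self _)
    rwa [smul_eq_mul, mul_comm] at this
  · intro h p hp
    obtain ⟨b, rfl⟩ := Ideal.mem_span_singleton'.1 hp
    have := (srIdeal k D).mul_mem_left b h
    rwa [smul_eq_mul, show f * (b * xFace k σ) = b * (xFace k σ * f) by ring]

lemma mem_linkIdeal {D : SC n} {σ : Finset (Fin n)} {f : MvPolynomial (Fin n) k} :
    f ∈ linkIdeal k D σ ↔ ∀ a ∈ f.support, a.support ∪ σ ∉ D.faces := by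
  rw [mem_linkIdeal_iff_mul, mem_srIdeal, xFace, prod_X_eq]
  constructor
  · intro h a ha
    rw [← support_chi_add]
    apply h
    rw [mem_support_iff, coeff_monomial_mul, one_mul]
    exact mem_support_iff.1 ha
  · intro h a ha
    rw [mem_support_iff, coeff_monomial_mul'] at ha
    split_ifs at ha with hle
    · rw [one_mul] at ha
      have := h _ (mem_support_iff.2 ha)
      rwa [← support_chi_add, add_tsub_cancel_of_le hle] at this
    · exact absurd rfl ha

lemma linkIdeal_empty (D : SC n) : linkIdeal k D ∅ = srIdeal k D := by
  ext f
  rw [mem_linkIdeal, mem_srIdeal]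
  simp

lemma homI_linkIdeal (D : SC n) (σ : Finset (Fin n)) : HomI (linkIdeal k D σ) := by
  intro f hf m
  rw [mem_linkIdeal] at hf ⊢
  intro a ha
  apply hf
  rw [mem_support_iff, coeff_homogeneousComponent] at ha
  rw [mem_support_iff]
  split_ifs at ha
  · exact ha
  · exact absurd rfl ha

lemma homI_srIdeal (D : SC n) : HomI (srIdeal k D) := linkIdeal_empty (k := k) D ▸ homI_linkIdeal D ∅

lemma linkIdeal_mono (D : SC n) {σ τ : Finset (Fin n)} (h : σ ⊆ τ) :
    linkIdeal k D σ ≤ linkIdeal k D τ := by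
  intro f hf
  rw [mem_linkIdeal] at hf ⊢
  exact fun a ha hD => hf a ha (D.down_closed _ hD _ (Finset.union_subset_union_right h))

/-- Division by the variable `X i`, discarding the terms not divisible by it. -/
def dv (i : Fin n) : MvPolynomial (Fin n) k →ₗ[k] MvPolynomial (Fin n) k where
  toFun f := f.divMonomial (Finsupp.single i 1)
  map_add' f g := add_divMonomial f g _
  map_smul' r f := by
    ext a
    simp [coeff_divMonomial]

lemma coeff_dv (i : Fin n) (f : MvPolynomial (Fin n) k) (a : Fin n →₀ ℕ) :
    coeff a (dv i f) = coeff (Finsupp.single i 1 + a) f := coeff_divMonomial _ _ _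

lemma dv_X_mul (i : Fin n) (f : MvPolynomial (Fin n) k) : dv i (X i * f) = f := X_mul_divMonomial i f

/-- Multiplication by `y` commutes with `dv i`. -/
def Free (i : Fin n) (y : MvPolynomial (Fin n) k) : Prop := ∀ f, dv i (y * f) = y * dv i f

lemma free_X {i l : Fin n} (h : l ≠ i) : Free i (X l : MvPolynomial (Fin n) k) := by
  intro f
  ext a
  rw [coeff_dv, coeff_X_mul', coeff_X_mul']
  have h1 : l ∈ (Finsupp.single i 1 + a).support ↔ l ∈ a.support := by
    simp [h.symm]
  simp only [h1]
  split_ifs with h2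
  · rw [coeff_dv]
    congr 1
    refine (add_tsub_assoc_of_le ?_ _)
    rw [Finsupp.single_le_iff]
    have := Finsupp.mem_support_iff.1 h2
    omega
  · rfl

lemma free_linForm {i : Fin n} {c : Fin n → k} (h : c i = 0) : Free i (linForm k c) := by
  intro f
  rw [linForm, Finset.sum_mul, map_sum, Finset.sum_mul]
  refine Finset.sum_congr rfl fun l _ => ?_
  rw [mul_assoc, mul_assoc, ← smul_eq_C_mul, ← smul_eq_C_mul, map_smul]
  by_cases hl : l = i
  · rw [hl, h, zero_smul, zero_smul]
  · rw [free_X hl]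

lemma dv_mem_linkIdeal {D : SC n} {σ τ : Finset (Fin n)} {i : Fin n} (h : τ = insert i σ)
    {f : MvPolynomial (Fin n) k} (hf : f ∈ linkIdeal k D σ) : dv i f ∈ linkIdeal k D τ := by
  rw [mem_linkIdeal] at hf ⊢
  intro a ha
  rw [mem_support_iff, coeff_dv] at ha
  have := hf _ (mem_support_iff.2 ha)
  have h2 := support_chi_add {i} a
  rw [chi, Finset.sum_singleton] at h2
  rw [h2] at this
  convert this using 2
  rw [h]
  ext j
  simp

lemma dv_mem_sup_ofList {i : Fin n} {J J' : Ideal (MvPolynomial (Fin n) k)}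
    (h : ∀ f ∈ J, dv i f ∈ J') (L : List (MvPolynomial (Fin n) k)) (hL : ∀ y ∈ L, Free i y) :
    ∀ f ∈ J ⊔ Ideal.ofList L, dv i f ∈ J' ⊔ Ideal.ofList L := by
  induction L with
  | nil => simpa using h
  | cons y L ih =>
    intro f hf
    rw [Ideal.ofList_cons, sup_comm (Ideal.span {y}), ← sup_assoc] at hf ⊢
    obtain ⟨b, hb⟩ := mem_sup_span_singleton_iff.1 hf
    refine mem_sup_span_singleton_iff.2 ⟨dv i b, ?_⟩
    have := ih (fun z hz => hL z (by simp [hz])) _ hb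
    rwa [_root_.map_sub, hL y (by simp)] at this

lemma Reg.of_free {i : Fin n} (L : List (MvPolynomial (Fin n) k)) :
    ∀ {J J' : Ideal (MvPolynomial (Fin n) k)}, (∀ f ∈ J, dv i f ∈ J') → (∀ f ∈ J', X i * f ∈ J) →
      (∀ y ∈ L, Free i y) → Reg J L → Reg J' L := by
  induction L with
  | nil => intros; trivial
  | cons y L ih =>
    intro J J' h1 h2 hL h
    refine ⟨fun a ha => ?_, ih (J := J ⊔ Ideal.span {y}) ?_ ?_ (fun z hz => hL z (by simp [hz])) h.2⟩
    · have := h2 _ ha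
      rw [mul_left_comm] at this
      simpa [dv_X_mul] using h1 _ (h.1 _ this)
    · simpa using dv_mem_sup_ofList h1 [y] (by simpa using hL y (by simp))
    · intro f hf
      obtain ⟨b, hb⟩ := mem_sup_span_singleton_iff.1 hf
      refine mem_sup_span_singleton_iff.2 ⟨X i * b, ?_⟩
      have := h2 _ hb
      rwa [mul_sub, mul_left_comm] at this

lemma exists_iterate_dv_eq_zero (i : Fin n) (a : MvPolynomial (Fin n) k) :
    ∃ N, (dv i)^[N] a = 0 := by
  have h : ∀ N b, coeff b ((dv i)^[N] a) = coeff (N • Finsupp.single i 1 + b) a := by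
    intro N
    induction N with
    | zero => simp
    | succ N ih =>
      intro b
      rw [Function.iterate_succ_apply', coeff_dv, ih, succ_nsmul, add_assoc]
  refine ⟨a.totalDegree + 1, ?_⟩
  ext b
  rw [h, coeff_zero]
  by_contra hne
  have := le_totalDegree (mem_support_iff.2 hne)
  have h2 := Finset.single_le_sum (f := ⇑((a.totalDegree + 1) • Finsupp.single i 1 + b : Fin n →₀ ℕ))
    (fun _ _ => Nat.zero_le _) (Finsupp.mem_support_iff.2
      (show ((a.totalDegree + 1) • Finsupp.single i 1 + b : Fin n →₀ ℕ) i ≠ 0 by simp))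
  have h3 := h2.trans this
  simp at h3
  omega

lemma NZ_of_dv_stable {i : Fin n} {J : Ideal (MvPolynomial (Fin n) k)} (hJ : ∀ f ∈ J, dv i f ∈ J)
    {r : k} (hr : r ≠ 0) {y : MvPolynomial (Fin n) k} (hy : Free i y) : NZ J (C r * X i + y) := by
  intro a ha
  have h1 : ∀ N, C r * (dv i)^[N] a + y * (dv i)^[N + 1] a ∈ J := by
    intro N
    induction N with
    | zero =>
      have := hJ _ ha
      rwa [add_mul, map_add, hy, mul_assoc, ← smul_eq_C_mul, map_smul, dv_X_mul,
        smul_eq_C_mul] at this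
    | succ N ih =>
      have := hJ _ ih
      rwa [map_add, hy, ← smul_eq_C_mul, map_smul, smul_eq_C_mul,
        ← Function.iterate_succ_apply' (dv i), ← Function.iterate_succ_apply' (dv i)] at this
  obtain ⟨N, hN⟩ := exists_iterate_dv_eq_zero i a
  have h2 : ∀ M, (dv i)^[M] a ∈ J → a ∈ J := by
    intro M
    induction M with
    | zero => exact id
    | succ M ih =>
      intro hM
      apply ih
      have h3 := J.sub_mem (h1 M) (J.mul_mem_left y hM)
      rw [add_sub_cancel_right] at h3
      have := J.mul_mem_left (C r⁻¹) h3
      rwa [← mul_assoc, ← C_mul, inv_mul_cancel₀ hr, C_1, one_mul] at this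
  exact h2 N (by rw [hN]; exact J.zero_mem)

lemma coeff_linForm (c : Fin n → k) (i : Fin n) :
    coeff (Finsupp.single i 1) (linForm k c) = c i := by
  rw [linForm, coeff_sum, Finset.sum_eq_single i]
  · simp
  · intro j _ hj
    rw [coeff_C_mul, coeff_X, if_neg, mul_zero]
    intro h
    exact hj (Finsupp.single_left_injective one_ne_zero h)
  · simp

lemma formList_succ {d : ℕ} (c : Fin (d + 1) × ι → k) :
    formList c = linForm k (fun i => c (0, i)) :: formList fun p : Fin d × ι => c (p.1.succ, p.2) := by
  rw [formList, List.ofFn_succ]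
  rfl

lemma isHomogeneous_of_mem_formList {d : ℕ} {c : Fin d × ι → k} {y : MvPolynomial ι k}
    (hy : y ∈ formList c) : y.IsHomogeneous 1 := by
  rw [formList, List.mem_ofFn] at hy
  obtain ⟨j, rfl⟩ := hy
  exact isHomogeneous_linForm _

lemma redIdeal_eq (J : Ideal (MvPolynomial ι k)) {d : ℕ} (c : Fin d × ι → k) :
    redIdeal k J c = J ⊔ Ideal.ofList (formList c) := by
  rw [redIdeal, Ideal.ofList]
  congr 2
  ext y
  simp [formList, List.mem_ofFn]

lemma X_mul_mem_srIdeal {D : SC n} {i : Fin n} {f : MvPolynomial (Fin n) k} :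
    X i * f ∈ srIdeal k D ↔ f ∈ linkIdeal k D {i} := by
  rw [mem_linkIdeal_iff_mul, xFace, Finset.prod_singleton]

lemma Hs_srIdeal_red {D : SC n} {d : ℕ} {c : Fin d × Fin n → k}
    (h : Reg (srIdeal k D) (formList c)) :
    Hs (redIdeal k (srIdeal k D) c) = (1 - PowerSeries.X) ^ d * Hs (srIdeal k D) := by
  rw [redIdeal_eq, Hs_sup_ofList _ (homI_srIdeal D) (fun y => isHomogeneous_of_mem_formList) h]
  simp [formList]

lemma Hs_linkIdeal_red {D : SC n} {d : ℕ} {c : Fin (d + 1) × Fin n → k}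
    (h : Reg (srIdeal k D) (formList c)) (i : Fin n) (hi : c (0, i) ≠ 0) :
    Hs (redIdeal k (linkIdeal k D {i}) c) =
      (1 - PowerSeries.X) ^ (d + 1) * Hs (linkIdeal k D {i}) := by
  rw [redIdeal_eq]
  rw [formList_succ] at h ⊢
  set x := linForm k (fun i => c (0, i)) with hx
  set L := formList fun p : Fin d × Fin n => c (p.1.succ, p.2) with hL
  let a : MvPolynomial (Fin n) k → MvPolynomial (Fin n) k := fun y =>
    C (coeff (Finsupp.single i 1) y / c (0, i))
  have hx1 : x.IsHomogeneous 1 := isHomogeneous_linForm _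
  have hform : ∀ y ∈ L.map (fun y => y - a y * x), ∃ c' : Fin n → k, c' i = 0 ∧ y = linForm k c' := by
    intro y hy
    obtain ⟨z, hz, rfl⟩ := List.mem_map.1 hy
    rw [hL, formList, List.mem_ofFn] at hz
    obtain ⟨j, rfl⟩ := hz
    refine ⟨(fun i => c (j.succ, i)) + (-(c (j.succ, i) / c (0, i))) • fun i => c (0, i), ?_, ?_⟩
    · simp [hi]
    · rw [linForm_add, linForm_smul, smul_eq_C_mul, ← hx, map_neg]
      simp only [a, coeff_linForm]
      ring
  have hhom : ∀ y ∈ L.map (fun y => y - a y * x), y.IsHomogeneous 1 := by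
    intro y hy
    obtain ⟨c', -, rfl⟩ := hform y hy
    exact isHomogeneous_linForm _
  have hfree : ∀ y ∈ L.map (fun y => y - a y * x), Free i y := by
    intro y hy
    obtain ⟨c', hc', rfl⟩ := hform y hy
    exact free_linForm hc'
  have h1 : Reg (srIdeal k D) (x :: L.map fun y => y - a y * x) :=
    ⟨h.1, Reg.map_sub x a L (Ideal.mem_sup_right (Ideal.mem_span_singleton_self x)) h.2⟩
  have h2 := (Reg.append_singleton _ _ ((homI_srIdeal D).reg_rotate _ hx1 hhom h1)).1
  have h3 : Reg (linkIdeal k D {i}) (L.map fun y => y - a y * x) := by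
    refine Reg.of_free _ (fun f hf => ?_) (fun f hf => X_mul_mem_srIdeal.2 hf) hfree h2
    replace hf : f ∈ linkIdeal k D ∅ := by rwa [linkIdeal_empty]
    exact dv_mem_linkIdeal (insert_empty_eq i).symm hf
  have h4 : NZ (linkIdeal k D {i} ⊔ Ideal.ofList (L.map fun y => y - a y * x)) x := by
    have : x = C (c (0, i)) * X i +
        linForm k ((fun i => c (0, i)) + (-c (0, i)) • (Pi.single i 1 : Fin n → k)) := by
      rw [linForm_add, linForm_smul, linForm_single, smul_eq_C_mul, ← hx, map_neg]
      ring
    have hst := dv_mem_sup_ofList (J := linkIdeal k D {i}) (J' := linkIdeal k D {i})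
      (fun f hf => dv_mem_linkIdeal (i := i) (by simp) hf) _ hfree
    have h7 := NZ_of_dv_stable hst hi (free_linForm (c := (fun i => c (0, i)) +
      (-c (0, i)) • (Pi.single i 1 : Fin n → k)) (by simp))
    rwa [← this] at h7
  have h5 : HomI (linkIdeal k D {i} ⊔ Ideal.ofList (L.map fun y => y - a y * x)) :=
    (homI_linkIdeal D _).sup (HomI.span fun f hf => ⟨1, hhom f hf⟩)
  have h6 : linkIdeal k D {i} ⊔ Ideal.ofList (x :: L) =
      linkIdeal k D {i} ⊔ Ideal.ofList (L.map fun y => y - a y * x) ⊔ Ideal.span {x} := by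
    rw [sup_right_comm, sup_ofList_map_sub x a L
      (Ideal.mem_sup_right (Ideal.mem_span_singleton_self x)), Ideal.ofList_cons, sup_assoc]
  rw [h6, Hs_sup_singleton h5 hx1 h4, Hs_sup_ofList _ (homI_linkIdeal D _) hhom h3]
  rw [List.length_map, hL, formList, List.length_ofFn, pow_succ']
  ring

end MonomialIdeals

section Counting

/-- The exponent vectors of degree `m` whose support together with `σ` is a face. -/
def faceExps (D : SC n) (σ : Finset (Fin n)) (m : ℕ) : Finset (Fin n →₀ ℕ) :=
  (Finset.finsuppAntidiag Finset.univ m).filter fun a => a.support ∪ σ ∈ D.faces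

lemma mem_faceExps {D : SC n} {σ : Finset (Fin n)} {m : ℕ} {a : Fin n →₀ ℕ} :
    a ∈ faceExps D σ m ↔ ∑ i, a i = m ∧ a.support ∪ σ ∈ D.faces := by
  simp [faceExps, Finset.mem_finsuppAntidiag]

variable {k}

lemma HFq_linkIdeal (D : SC n) (σ : Finset (Fin n)) (m : ℕ) :
    HFq k (linkIdeal k D σ) m = (faceExps D σ m).card := by
  let v : faceExps D σ m → MvPolynomial (Fin n) k ⧸ linkIdeal k D σ := fun a =>
    Ideal.Quotient.mk _ (monomial a.1 1)
  have hv : LinearIndependent k v := by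
    rw [Fintype.linearIndependent_iff]
    intro g hg a
    by_contra hne
    have h1 : ∑ b, g b • v b = Ideal.Quotient.mk (linkIdeal k D σ)
        (∑ b : faceExps D σ m, monomial b.1 (g b)) := by
      rw [map_sum]
      refine Finset.sum_congr rfl fun b _ => ?_
      rw [show (monomial b.1 (g b) : MvPolynomial (Fin n) k) = g b • monomial b.1 1 by
        rw [smul_monomial, smul_eq_mul, mul_one]]
      rfl
    rw [h1] at hg
    have h2 := mem_linkIdeal.1 (Ideal.Quotient.eq_zero_iff_mem.1 hg) a.1 (by
      rw [mem_support_iff, coeff_sum, Finset.sum_eq_single a]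
      · simpa using hne
      · intro b _ hb
        rw [coeff_monomial, if_neg]
        exact fun h => hb (Subtype.ext h)
      · simp)
    exact h2 (mem_faceExps.1 a.2).2
  have hspan : Submodule.span k (Set.range v) = qComp k (linkIdeal k D σ) m := by
    apply le_antisymm
    · rw [Submodule.span_le]
      rintro _ ⟨a, rfl⟩
      refine mk_mem_qComp (isHomogeneous_monomial _ ?_)
      rw [Finsupp.degree_eq_sum]
      exact (mem_faceExps.1 a.2).1
    · rintro _ ⟨f, hf, rfl⟩
      change Ideal.Quotient.mk _ f ∈ _
      rw [f.as_sum, map_sum]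
      refine Submodule.sum_mem _ fun a ha => ?_
      by_cases haD : a.support ∪ σ ∈ D.faces
      · have ham : a ∈ faceExps D σ m := by
          refine mem_faceExps.2 ⟨?_, haD⟩
          rw [← Finsupp.degree_eq_sum]
          by_contra hne
          exact mem_support_iff.1 ha (IsHomogeneous.coeff_eq_zero hf hne)
        rw [show (monomial a (coeff a f) : MvPolynomial (Fin n) k) = coeff a f • monomial a 1 by
          rw [smul_monomial, smul_eq_mul, mul_one]]
        have hmem : v ⟨a, ham⟩ ∈ Submodule.span k (Set.range v) :=
          Submodule.subset_span (Set.mem_range_self _)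
        exact Submodule.smul_mem _ (coeff a f) hmem
      · rw [Ideal.Quotient.eq_zero_iff_mem.2]
        · exact Submodule.zero_mem _
        · rw [mem_linkIdeal]
          intro b hb
          rw [Finset.mem_singleton.1 (support_monomial_subset hb)]
          exact haD
  rw [HFq, ← hspan, finrank_span_eq_card hv, Fintype.card_coe]

lemma sum_faceExps_apply (D : SC n) (i : Fin n) (m : ℕ) :
    ∑ a ∈ faceExps D ∅ (m + 1), a i = (faceExps D {i} m).card + ∑ b ∈ faceExps D ∅ m, b i := by
  have h1 : ∑ a ∈ faceExps D ∅ (m + 1), a i = ∑ b ∈ faceExps D {i} m, (b i + 1) := by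
    rw [← Finset.sum_filter_ne_zero]
    symm
    refine Finset.sum_bij (fun b _ => chi {i} + b) ?_ ?_ ?_ ?_
    · intro b hb
      rw [mem_faceExps] at hb
      rw [Finset.mem_filter, mem_faceExps, Finset.union_empty, support_chi_add]
      refine ⟨⟨?_, hb.2⟩, ?_⟩
      · simp [chi_apply, Finset.sum_add_distrib, hb.1, add_comm]
      · simp [chi_apply]
    · intro a _ b _ h
      exact add_left_cancel h
    · intro a ha
      rw [Finset.mem_filter, mem_faceExps, Finset.union_empty] at ha
      have hle : chi {i} ≤ a := by
        rw [chi_le_iff]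
        simpa using ha.2
      have heq := add_tsub_cancel_of_le hle
      refine ⟨a - chi {i}, ?_, heq⟩
      rw [mem_faceExps, ← support_chi_add, heq]
      refine ⟨?_, ha.1.2⟩
      have := ha.1.1
      rw [← heq] at this
      simp only [Finsupp.add_apply, Finset.sum_add_distrib, chi_apply, Finset.mem_singleton,
        Finset.sum_ite_eq', Finset.mem_univ, if_true] at this
      omega
    · intro b _
      simp [chi_apply, add_comm]
  have h2 : ∑ b ∈ faceExps D {i} m, b i = ∑ b ∈ faceExps D ∅ m, b i := by
    refine Finset.sum_subset_zero_on_sdiff ?_ ?_ fun _ _ => rfl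
    · intro b hb
      rw [mem_faceExps] at hb ⊢
      exact ⟨hb.1, D.down_closed _ hb.2 _ (Finset.union_subset_union_right (Finset.empty_subset _))⟩
    · intro b hb
      rw [Finset.mem_sdiff, mem_faceExps, mem_faceExps] at hb
      by_contra hne
      apply hb.2
      refine ⟨hb.1.1, ?_⟩
      rw [Finset.union_eq_left.2]
      · simpa using hb.1.2
      · simpa using hne
  rw [h1, Finset.sum_add_distrib, h2]
  simp [add_comm]

lemma succ_mul_HFq_srIdeal (D : SC n) (m : ℕ) :
    (m + 1) * HFq k (srIdeal k D) (m + 1) =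
      ∑ i, HFq k (linkIdeal k D {i}) m + m * HFq k (srIdeal k D) m := by
  have h : ∀ m, m * (faceExps D ∅ m).card = ∑ i, ∑ a ∈ faceExps D ∅ m, a i := by
    intro m
    rw [Finset.sum_comm, Finset.sum_congr rfl fun a ha => (mem_faceExps.1 ha).1]
    simp [mul_comm]
  rw [← linkIdeal_empty]
  simp only [HFq_linkIdeal]
  rw [h, h, Finset.sum_congr rfl fun i _ => sum_faceExps_apply D i m, Finset.sum_add_distrib]

lemma Hs_srIdeal_derivative (D : SC n) :
    (1 - PowerSeries.X) * PowerSeries.derivative ℤ (Hs (srIdeal k D)) =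
      ∑ i, Hs (linkIdeal k D {i}) := by
  ext m
  rw [sub_mul, one_mul, _root_.map_sub, map_sum]
  cases m with
  | zero =>
    have := succ_mul_HFq_srIdeal (k := k) D 0
    rw [PowerSeries.coeff_zero_X_mul, PowerSeries.coeff_derivative]
    simp only [Hs, PowerSeries.coeff_mk]
    push_cast [← Nat.cast_sum] at this ⊢
    simpa using congrArg (Nat.cast : ℕ → ℤ) this
  | succ m =>
    have := congrArg (Nat.cast : ℕ → ℤ) (succ_mul_HFq_srIdeal (k := k) D (m + 1))
    rw [PowerSeries.coeff_succ_X_mul, PowerSeries.coeff_derivative, PowerSeries.coeff_derivative]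
    simp only [Hs, PowerSeries.coeff_mk]
    push_cast at this ⊢
    linarith

lemma sum_HFq_link_red {D : SC n} {d : ℕ} {c : Fin (d + 1) × Fin n → k}
    (h : Reg (srIdeal k D) (formList c)) (hc : ∀ i, c (0, i) ≠ 0) (s : ℕ) :
    ∑ i, (HFq k (redIdeal k (linkIdeal k D {i}) c) s : ℤ) =
      (s + 1) * HFq k (redIdeal k (srIdeal k D) c) (s + 1) +
        ((d + 1 : ℕ) - s) * HFq k (redIdeal k (srIdeal k D) c) s := by
  have h1 : ∑ i, Hs (redIdeal k (linkIdeal k D {i}) c) =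
      (1 - PowerSeries.X) * PowerSeries.derivative ℤ (Hs (redIdeal k (srIdeal k D) c)) +
        ((d + 1 : ℕ) : PowerSeries ℤ) * Hs (redIdeal k (srIdeal k D) c) := by
    rw [Finset.sum_congr rfl fun i _ => Hs_linkIdeal_red h i (hc i), Hs_srIdeal_red h,
      ← Finset.mul_sum, ← Hs_srIdeal_derivative, Derivation.leibniz, Derivation.leibniz_pow]
    simp only [_root_.map_sub, Derivation.map_one_eq_zero, PowerSeries.derivative_X, smul_eq_mul,
      nsmul_eq_mul, Nat.add_sub_cancel]
    ring
  have h2 := congrArg (PowerSeries.coeff s) h1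
  rw [map_sum, map_add, sub_mul, one_mul, _root_.map_sub, ← nsmul_eq_mul, map_nsmul] at h2
  cases s with
  | zero =>
    rw [PowerSeries.coeff_zero_X_mul, PowerSeries.coeff_derivative] at h2
    simp only [Hs, PowerSeries.coeff_mk] at h2
    rw [h2]
    push_cast
    simp
  | succ s =>
    rw [PowerSeries.coeff_succ_X_mul, PowerSeries.coeff_derivative,
      PowerSeries.coeff_derivative] at h2
    simp only [Hs, PowerSeries.coeff_mk] at h2
    rw [h2]
    push_cast
    simp
    ring

end Counting

section Openness

variable {k}

lemma exists_open_surjective {V W τ : Type} [Fintype τ] [AddCommGroup V] [Module k V]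
    [AddCommGroup W] [Module k W] [FiniteDimensional k W] (Φ : τ → V →ₗ[k] W) (c₀ : τ → k)
    (h₀ : Function.Surjective (∑ p, c₀ p • Φ p : V →ₗ[k] W)) :
    ∃ g : MvPolynomial τ k, eval c₀ g ≠ 0 ∧ ∀ c, eval c g ≠ 0 →
      Function.Surjective (∑ p, c p • Φ p : V →ₗ[k] W) := by
  obtain ⟨S, hS⟩ := LinearMap.exists_rightInverse_of_surjective _ (LinearMap.range_eq_top.2 h₀)
  let b := Module.finBasis k W
  let M : Matrix _ _ (MvPolynomial τ k) :=
    ∑ p, (X p : MvPolynomial τ k) • (LinearMap.toMatrix b b (Φ p ∘ₗ S)).map C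
  have hM : ∀ c, eval c M.det = LinearMap.det ((∑ p, c p • Φ p : V →ₗ[k] W) ∘ₗ S) := by
    intro c
    rw [← LinearMap.det_toMatrix b, RingHom.map_det]
    congr 1
    ext i j
    simp [M, Matrix.sum_apply, LinearMap.toMatrix_apply]
  refine ⟨M.det, ?_, ?_⟩
  · rw [hM, hS]
    simp
  · intro c hc
    rw [hM] at hc
    have h1 : Function.Surjective ((∑ p, c p • Φ p : V →ₗ[k] W) ∘ₗ S) :=
      (LinearMap.equivOfDetNeZero _ hc).surjective
    exact Function.Surjective.of_comp h1

lemma mem_redIdeal {J : Ideal (MvPolynomial ι k)} {d : ℕ} {c : Fin d × ι → k}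
    {a : MvPolynomial ι k} : a ∈ redIdeal k J c ↔
      ∃ b : Fin d → MvPolynomial ι k, a - ∑ j, linForm k (fun i => c (j, i)) * b j ∈ J := by
  rw [redIdeal, Submodule.mem_sup]
  constructor
  · rintro ⟨f, hf, z, hz, rfl⟩
    obtain ⟨b, rfl⟩ := Ideal.mem_span_range_iff_exists_fun.1 hz
    refine ⟨b, ?_⟩
    simpa [mul_comm] using hf
  · rintro ⟨b, hb⟩
    refine ⟨_, hb, _, Ideal.mem_span_range_iff_exists_fun.2 ⟨b, rfl⟩, ?_⟩
    simp [mul_comm]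

lemma exists_homogeneous_of_mem_redIdeal {J : Ideal (MvPolynomial ι k)} (hJ : HomI J) {d : ℕ}
    {c : Fin d × ι → k} {a : MvPolynomial ι k} {m : ℕ} (ha : a.IsHomogeneous (m + 1))
    (h : a ∈ redIdeal k J c) :
    ∃ b : Fin d → MvPolynomial ι k, (∀ j, (b j).IsHomogeneous m) ∧
      a - ∑ j, linForm k (fun i => c (j, i)) * b j ∈ J := by
  obtain ⟨b, hb⟩ := mem_redIdeal.1 h
  refine ⟨fun j => homogeneousComponent m (b j), fun j => homogeneousComponent_isHomogeneous _ _, ?_⟩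
  have := hJ _ hb (m + 1)
  rw [_root_.map_sub, map_sum, homogeneousComponent_eq_self ha] at this
  simpa only [homogeneousComponent_succ_mul (isHomogeneous_linForm _)] using this

lemma homI_redIdeal {J : Ideal (MvPolynomial ι k)} (hJ : HomI J) {d : ℕ} (c : Fin d × ι → k) :
    HomI (redIdeal k J c) := by
  rw [redIdeal_eq]
  exact hJ.sup (HomI.span fun f hf => ⟨1, isHomogeneous_of_mem_formList hf⟩)

lemma exists_open_redIdeal {J : Ideal (MvPolynomial ι k)} (hJ : HomI J) {d : ℕ}
    (c₀ : Fin d × ι → k) (m : ℕ)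
    (h₀ : ∀ a : MvPolynomial ι k, a.IsHomogeneous (m + 1) → a ∈ redIdeal k J c₀) :
    ∃ g : MvPolynomial (Fin d × ι) k, eval c₀ g ≠ 0 ∧ ∀ c, eval c g ≠ 0 →
      ∀ a : MvPolynomial ι k, a.IsHomogeneous (m + 1) → a ∈ redIdeal k J c := by
  let Φ : Fin d × ι → (Fin d → homogeneousSubmodule ι k m) →ₗ[k] qComp k J (m + 1) := fun p =>
    LinearMap.codRestrict _ ((Ideal.Quotient.mkₐ k J).toLinearMap ∘ₗ
      LinearMap.mulLeft k (X p.2) ∘ₗ (homogeneousSubmodule ι k m).subtype ∘ₗ LinearMap.proj p.1)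
      (fun v => mk_mem_qComp (by
        rw [add_comm]
        exact (isHomogeneous_X k p.2).mul (v p.1).2))
  have hΦ : ∀ (c : Fin d × ι → k) (v : Fin d → homogeneousSubmodule ι k m),
      ((∑ p, c p • Φ p : (Fin d → homogeneousSubmodule ι k m) →ₗ[k] qComp k J (m + 1)) v :
        MvPolynomial ι k ⧸ J) =
      Ideal.Quotient.mk J (∑ j, linForm k (fun i => c (j, i)) * (v j : MvPolynomial ι k)) := by
    intro c v
    rw [LinearMap.sum_apply, Submodule.coe_sum, map_sum, Fintype.sum_prod_type]
    refine Finset.sum_congr rfl fun j _ => ?_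
    rw [linForm, Finset.sum_mul, map_sum]
    refine Finset.sum_congr rfl fun i _ => ?_
    rw [mul_assoc, ← smul_eq_C_mul]
    rfl
  have key : ∀ c, Function.Surjective
      (∑ p, c p • Φ p : (Fin d → homogeneousSubmodule ι k m) →ₗ[k] qComp k J (m + 1)) ↔
      ∀ a : MvPolynomial ι k, a.IsHomogeneous (m + 1) → a ∈ redIdeal k J c := by
    intro c
    constructor
    · intro h a ha
      obtain ⟨v, hv⟩ := h ⟨_, mk_mem_qComp ha⟩
      have := congrArg Subtype.val hv
      rw [hΦ] at this
      exact mem_redIdeal.2 ⟨fun j => v j, (Ideal.Quotient.eq).1 this.symm⟩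
    · rintro h ⟨_, a, ha, rfl⟩
      obtain ⟨b, hb, hab⟩ := exists_homogeneous_of_mem_redIdeal hJ ha (h a ha)
      refine ⟨fun j => ⟨b j, hb j⟩, Subtype.ext ?_⟩
      rw [hΦ]
      exact ((Ideal.Quotient.eq).2 hab).symm
  obtain ⟨g, hg, hg'⟩ := exists_open_surjective Φ c₀ ((key c₀).2 h₀)
  exact ⟨g, hg, fun c hc => (key c).1 (hg' c hc)⟩

end Openness

section Vanishing

variable {k}

lemma exists_coeff_combination {d : ℕ} {t : Fin n → k} (ht : Function.Injective t)
    {F : Finset (Fin n)} (hF : F.card ≤ d) {i : Fin n} (hi : i ∈ F) :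
    ∃ r : Fin n → k, r i = 1 ∧ (∀ l ∈ F, l ≠ i → r l = 0) ∧ ∀ J : Ideal (MvPolynomial (Fin n) k),
      linForm k r ∈ redIdeal k J fun p : Fin d × Fin n => t p.2 ^ (p.1 : ℕ) := by
  let P := Lagrange.basis F t i
  have hdeg : P.natDegree < d := by
    have h1 := Lagrange.degree_basis (s := F) (ht.injOn) hi
    rw [Polynomial.natDegree_eq_of_degree_eq_some h1]
    have := Finset.card_pos.2 ⟨i, hi⟩
    omega
  refine ⟨fun l => P.eval (t l), Lagrange.eval_basis_self ht.injOn hi,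
    fun l hl hli => Lagrange.eval_basis_of_ne hli.symm hl, fun J => ?_⟩
  refine Ideal.mem_sup_right ?_
  rw [Ideal.mem_span_range_iff_exists_fun]
  refine ⟨fun j => C (P.coeff j), ?_⟩
  simp only [linForm, Finset.mul_sum]
  rw [Finset.sum_comm]
  refine Finset.sum_congr rfl fun l _ => ?_
  rw [Polynomial.eval_eq_sum_range' hdeg, ← Fin.sum_univ_eq_sum_range (fun j => P.coeff j * t l ^ j),
    map_sum, Finset.sum_mul]
  refine Finset.sum_congr rfl fun j _ => ?_
  rw [C_mul, mul_assoc]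

lemma mem_redIdeal_of_degree_gt {D : SC n} {t : Fin n → k} (ht : Function.Injective t)
    (σ : Finset (Fin n)) {m : ℕ} (hm : dimP D < m + σ.card) {f : MvPolynomial (Fin n) k}
    (hf : f.IsHomogeneous m) : f ∈ redIdeal k (linkIdeal k D σ)
      fun p : Fin (dimP D) × Fin n => t p.2 ^ (p.1 : ℕ) := by
  set K := redIdeal k (linkIdeal k D σ) fun p : Fin (dimP D) × Fin n => t p.2 ^ (p.1 : ℕ) with hK
  have key : ∀ r, ∀ a : Fin n →₀ ℕ, a.degree = m → n < (a.support ∪ σ).card + r →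
      monomial a (1 : k) ∈ K := by
    intro r
    induction r with
    | zero =>
      intro a _ hlt
      have := Finset.card_le_univ (a.support ∪ σ)
      rw [Fintype.card_fin] at this
      omega
    | succ r ih =>
      intro a ha hlt
      by_cases hD : a.support ∪ σ ∈ D.faces
      swap
      · refine Ideal.mem_sup_left ?_
        rw [mem_linkIdeal]
        intro b hb
        rwa [Finset.mem_singleton.1 (support_monomial_subset hb)]
      have hcard : (a.support ∪ σ).card ≤ dimP D := Finset.le_sup (f := Finset.card) hD
      obtain ⟨i, hia, hi⟩ : ∃ i ∈ a.support, i ∈ σ ∨ 2 ≤ a i := by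
        by_contra! H
        have h1 : Disjoint a.support σ := by
          rw [Finset.disjoint_left]
          exact fun i hi => (H i hi).1
        have h2 : a.degree ≤ a.support.card := by
          rw [Finsupp.degree_apply, ← mul_one a.support.card]
          refine Finset.sum_le_card_nsmul _ _ _ fun i hi => ?_
          have := (H i hi).2
          omega
        rw [Finset.card_union_of_disjoint h1] at hcard
        omega
      have hle : chi {i} ≤ a := by
        rw [chi_le_iff]
        simpa using hia
      have heq := add_tsub_cancel_of_le hle
      have hsupp : (a - chi {i}).support ∪ σ = a.support ∪ σ := by
        conv_rhs => rw [← heq]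
        rw [support_chi_add]
        ext j
        simp only [Finset.mem_union, Finset.mem_singleton, Finsupp.mem_support_iff,
          Finsupp.tsub_apply, chi_apply]
        constructor
        · tauto
        · rintro ((h | rfl) | h)
          · exact Or.inl h
          · rcases hi with hi | hi
            · exact Or.inr hi
            · left
              simp
              omega
          · exact Or.inr h
      obtain ⟨r, hri, hr0, hr⟩ := exists_coeff_combination ht hcard (Finset.mem_union_left σ hia)
      have hdeg : (a - chi {i}).degree + 1 = m := by
        rw [← ha]
        conv_rhs => rw [← heq]
        rw [map_add, add_comm]
        simp [chi]
      have h1 := K.mul_mem_right (monomial (a - chi {i}) (1 : k)) (hr (linkIdeal k D σ))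
      rw [linForm, Finset.sum_mul, ← Finset.add_sum_erase _ _ (Finset.mem_univ i), hri] at h1
      have hX : ∀ l, (X l * monomial (a - chi {i}) 1 : MvPolynomial (Fin n) k) =
          monomial (chi {l} + (a - chi {i})) 1 := by
        intro l
        have hchi : chi {l} = Finsupp.single l 1 := by rw [chi, Finset.sum_singleton]
        rw [X, monomial_mul, mul_one, hchi]
      have h2 : ∑ l ∈ Finset.univ.erase i, C (r l) * X l * monomial (a - chi {i}) (1 : k) ∈ K := by
        refine Ideal.sum_mem _ fun l hl => ?_
        by_cases hlF : l ∈ a.support ∪ σ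
        · rw [hr0 l hlF (Finset.ne_of_mem_erase hl)]
          simp
        · rw [mul_assoc, hX]
          refine Ideal.mul_mem_left _ _ (ih _ ?_ ?_)
          · rw [map_add, ← hdeg, add_comm]
            simp [chi]
          · rw [support_chi_add, Finset.union_right_comm, hsupp,
              Finset.card_union_of_disjoint (Finset.disjoint_singleton_right.2 hlF),
              Finset.card_singleton]
            omega
      rw [Ideal.add_mem_iff_left _ h2, C_1, one_mul, hX, heq] at h1
      exact h1
  rw [f.as_sum]
  refine Ideal.sum_mem _ fun a ha => ?_
  rw [← mul_one (coeff a f), ← C_mul_monomial]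
  refine Ideal.mul_mem_left _ _ (key (n + 1) a ?_ (by omega))
  by_contra hne
  exact mem_support_iff.1 ha (hf.coeff_eq_zero hne)

end Vanishing

section Duality

variable {k}

lemma mk_mem_socle {J : Ideal (MvPolynomial ι k)} {a : MvPolynomial ι k} :
    Ideal.Quotient.mk J a ∈ socle k J ↔ ∀ i, X i * a ∈ J := by
  rw [socle, Submodule.mem_iInf]
  refine forall_congr' fun i => ?_
  rw [LinearMap.mem_ker, LinearMap.mulLeft_apply, ← map_mul, Ideal.Quotient.eq_zero_iff_mem]

/-- `k[X] ⧸ J` is an Artinian Gorenstein graded algebra of socle degree `s`. -/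
structure SocDeg (J : Ideal (MvPolynomial ι k)) (s : ℕ) : Prop where
  hom : HomI J
  gor : artGor k J
  vanish : ∀ a : MvPolynomial ι k, a.IsHomogeneous (s + 1) → a ∈ J
  top : ∃ v : MvPolynomial ι k, v.IsHomogeneous s ∧ v ∉ J

lemma exists_sub_smul_mem_of_socle {J : Ideal (MvPolynomial ι k)} (hJ : artGor k J)
    {a v : MvPolynomial ι k} (hv : v ∉ J) (hvs : ∀ i, X i * v ∈ J) (has : ∀ i, X i * a ∈ J) :
    ∃ r : k, a - r • v ∈ J := by
  have hv0 : (⟨Ideal.Quotient.mk J v, mk_mem_socle.2 hvs⟩ : socle k J) ≠ 0 := by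
    intro h
    exact hv (Ideal.Quotient.eq_zero_iff_mem.1 (congrArg Subtype.val h))
  obtain ⟨r, hr⟩ := (finrank_eq_one_iff_of_nonzero' _ hv0).1 hJ.2
    ⟨Ideal.Quotient.mk J a, mk_mem_socle.2 has⟩
  refine ⟨r, Ideal.Quotient.eq.1 ?_⟩
  exact (congrArg Subtype.val hr).symm

namespace SocDeg

variable {J : Ideal (MvPolynomial ι k)} {s : ℕ}

lemma X_mul_mem (h : SocDeg J s) {a : MvPolynomial ι k} (ha : a.IsHomogeneous s) (i : ι) :
    X i * a ∈ J :=
  h.vanish _ (by rw [add_comm]; exact (isHomogeneous_X k i).mul ha)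

lemma exists_mul_notMem (h : SocDeg J s) (e : ℕ) : ∀ {j : ℕ}, j + e = s →
    ∀ {a : MvPolynomial ι k}, a.IsHomogeneous j → a ∉ J →
      ∃ b : MvPolynomial ι k, b.IsHomogeneous e ∧ a * b ∉ J := by
  induction e with
  | zero => exact fun _ _ _ ha => ⟨1, isHomogeneous_one _ _, by simpa using ha⟩
  | succ e ih =>
    intro j hj a ha haJ
    obtain ⟨v, hv, hvJ⟩ := h.top
    by_cases H : ∀ i, X i * a ∈ J
    · obtain ⟨r, hr⟩ := exists_sub_smul_mem_of_socle h.gor hvJ (h.X_mul_mem hv) H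
      have := h.hom _ hr j
      rw [_root_.map_sub, map_smul, homogeneousComponent_eq_self ha,
        homogeneousComponent_of_mem hv, if_neg (by omega), smul_zero, sub_zero] at this
      exact absurd this haJ
    · push Not at H
      obtain ⟨i, hi⟩ := H
      obtain ⟨b, hb, hab⟩ := ih (j := 1 + j) (by omega) ((isHomogeneous_X k i).mul ha) hi
      refine ⟨X i * b, by rw [add_comm]; exact (isHomogeneous_X k i).mul hb, ?_⟩
      rwa [show a * (X i * b) = X i * a * b by ring]

lemma exists_functional (h : SocDeg J s) : ∃ φ : (MvPolynomial ι k ⧸ J) →ₗ[k] k,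
    ∀ a : MvPolynomial ι k, a.IsHomogeneous s → φ (Ideal.Quotient.mk J a) = 0 → a ∈ J := by
  obtain ⟨v, hv, hvJ⟩ := h.top
  obtain ⟨φ, hφ⟩ : ∃ φ : Module.Dual k (MvPolynomial ι k ⧸ J), φ (Ideal.Quotient.mk J v) ≠ 0 := by
    by_contra! H
    exact hvJ (Ideal.Quotient.eq_zero_iff_mem.1 ((Module.forall_dual_apply_eq_zero_iff k _).1 H))
  refine ⟨φ, fun a ha h0 => ?_⟩
  obtain ⟨r, hr⟩ := exists_sub_smul_mem_of_socle h.gor hvJ (h.X_mul_mem hv) (h.X_mul_mem ha)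
  have h1 : Ideal.Quotient.mk J a = r • Ideal.Quotient.mk J v := Ideal.Quotient.eq.2 hr
  rw [h1, map_smul, smul_eq_mul, mul_eq_zero, or_iff_left hφ] at h0
  rwa [h0, zero_smul, sub_zero] at hr

lemma mul_injective_of_surjective (h : SocDeg J s) {ω : MvPolynomial ι k} {j m : ℕ}
    (hjm : j + (m + 1) = s)
    (hsurj : ∀ a : MvPolynomial ι k, a.IsHomogeneous (m + 1) →
      ∃ b : MvPolynomial ι k, b.IsHomogeneous m ∧ a - ω * b ∈ J)
    {a : MvPolynomial ι k} (ha : a.IsHomogeneous j) (hωa : ω * a ∈ J) : a ∈ J := by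
  by_contra haJ
  obtain ⟨b, hb, hab⟩ := h.exists_mul_notMem _ hjm ha haJ
  obtain ⟨c, -, hc⟩ := hsurj b hb
  apply hab
  have := J.add_mem (J.mul_mem_left a hc) (J.mul_mem_right c hωa)
  rwa [show a * (b - ω * c) + ω * a * c = a * b by ring] at this

lemma mul_surjective_of_injective (h : SocDeg J s) {ω : MvPolynomial ι k}
    (hω : ω.IsHomogeneous 1) {j m : ℕ} (hjm : j + (m + 1) = s)
    (hinj : ∀ a : MvPolynomial ι k, a.IsHomogeneous j → ω * a ∈ J → a ∈ J)
    {a : MvPolynomial ι k} (ha : a.IsHomogeneous (m + 1)) :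
    ∃ b : MvPolynomial ι k, b.IsHomogeneous m ∧ a - ω * b ∈ J := by
  obtain ⟨φ, hφ⟩ := h.exists_functional
  let B : ∀ e f : ℕ, qComp k J e →ₗ[k] qComp k J f →ₗ[k] k := fun e f =>
    ((LinearMap.mul k (MvPolynomial ι k ⧸ J)).compr₂ φ).domRestrict₁₂ (qComp k J e) (qComp k J f)
  have hB : ∀ e f (x : qComp k J e) (y : qComp k J f), B e f x y = φ (x.1 * y.1) :=
    fun _ _ _ _ => rfl
  have hBinj : ∀ e f, e + f = s → Function.Injective (B e f) := by
    intro e f hef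
    rw [← LinearMap.ker_eq_bot, eq_bot_iff]
    rintro ⟨x, hx⟩ hx0
    obtain ⟨a, ha, rfl⟩ := mem_qComp.1 hx
    have h1 : a ∈ J := by
      by_contra haJ
      obtain ⟨b, hb, hab⟩ := h.exists_mul_notMem _ hef ha haJ
      refine hab (hφ _ (hef ▸ ha.mul hb) ?_)
      have := LinearMap.congr_fun (LinearMap.mem_ker.1 hx0) ⟨_, mk_mem_qComp hb⟩
      rw [hB] at this
      simpa using this
    exact Subtype.ext (Ideal.Quotient.eq_zero_iff_mem.2 h1)
  have hflip : ∀ e f, (B e f).flip = B f e := by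
    intro e f
    ext x y
    rw [LinearMap.flip_apply, hB, hB, mul_comm]
  have hperf : (B j (m + 1)).IsPerfPair :=
    LinearMap.IsPerfPair.of_injective (hBinj _ _ hjm)
      (by rw [hflip]; exact hBinj _ _ (by omega))
  let Ω : qComp k J m →ₗ[k] qComp k J (m + 1) :=
    (LinearMap.mulLeft k (Ideal.Quotient.mk J ω)).restrict (by
      rintro _ ⟨b, hb, rfl⟩
      exact mem_qComp.2 ⟨ω * b, by rw [add_comm]; exact hω.mul hb, map_mul _ _ _⟩)
  have hΩ : Function.Surjective Ω := by
    rw [← LinearMap.dualMap_injective_iff, ← LinearMap.ker_eq_bot, eq_bot_iff]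
    intro f hf
    obtain ⟨x, rfl⟩ := hperf.bijective_left.2 f
    obtain ⟨x, hx⟩ := x
    obtain ⟨c, hc, rfl⟩ := mem_qComp.1 hx
    have hωc : (ω * c).IsHomogeneous (j + 1) := by rw [add_comm]; exact hω.mul hc
    have h1 : B (j + 1) m ⟨_, mk_mem_qComp hωc⟩ = 0 := by
      ext y
      have := LinearMap.congr_fun (LinearMap.mem_ker.1 hf) y
      rw [LinearMap.dualMap_apply, hB] at this
      rw [hB]
      rw [LinearMap.zero_apply] at this ⊢
      rw [← this]
      have h2 : Ideal.Quotient.mk J (ω * c) * y.1 =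
          Ideal.Quotient.mk J c * (Ideal.Quotient.mk J ω * y.1) := by
        rw [RingHom.map_mul]
        ring
      exact congrArg φ h2
    have h2 := hBinj (j + 1) m (by omega) (h1.trans (map_zero _).symm)
    have h3 : c ∈ J := hinj c hc (Ideal.Quotient.eq_zero_iff_mem.1 (congrArg Subtype.val h2))
    have h4 : (⟨Ideal.Quotient.mk J c, hx⟩ : qComp k J j) = 0 :=
      Subtype.ext (Ideal.Quotient.eq_zero_iff_mem.2 h3)
    rw [h4, map_zero]
    exact Submodule.zero_mem _
  obtain ⟨⟨_, b, hb, rfl⟩, hy⟩ := hΩ ⟨_, mk_mem_qComp ha⟩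
  refine ⟨b, hb, Ideal.Quotient.eq.1 ?_⟩
  exact (congrArg Subtype.val hy).symm

end SocDeg

end Duality

section SocleDegree

variable {k}

lemma mem_of_isHomogeneous_le {J : Ideal (MvPolynomial ι k)} {m : ℕ}
    (h : ∀ a : MvPolynomial ι k, a.IsHomogeneous m → a ∈ J) {e : ℕ} (hme : m ≤ e)
    {a : MvPolynomial ι k} (ha : a.IsHomogeneous e) : a ∈ J := by
  rw [a.as_sum]
  refine J.sum_mem fun b hb => ?_
  have hdeg : b.degree = e := by
    by_contra hne
    exact mem_support_iff.1 hb (ha.coeff_eq_zero hne)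
  obtain ⟨b', hb', hdeg'⟩ : ∃ b' ≤ b, b'.degree = m := by
    exact Finsupp.exists_le_degree_eq b m (by omega)
  rw [← add_tsub_cancel_of_le hb', ← one_mul (coeff _ a), ← monomial_mul]
  exact J.mul_mem_right _ (h _ (isHomogeneous_monomial _ hdeg'))

lemma false_of_early_socle {D : SC n} {d : ℕ} {c : Fin (d + 1) × Fin n → k}
    (hreg : Reg (srIdeal k D) (formList c)) (hc : ∀ i, c (0, i) ≠ 0)
    (hgor : artGor k (redIdeal k (srIdeal k D) c))
    (hvan : ∀ a : MvPolynomial (Fin n) k, a.IsHomogeneous (d + 1) →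
      a ∈ redIdeal k (srIdeal k D) c)
    (h3 : ∀ i : Fin n, ∃ τ ∈ D.faces, insert i τ ∉ D.faces) : False := by
  set J := redIdeal k (srIdeal k D) c with hJ
  have hone : (1 : MvPolynomial (Fin n) k) ∉ J := by
    intro h
    have : Subsingleton (MvPolynomial (Fin n) k ⧸ J) :=
      Ideal.Quotient.subsingleton_iff.2 ((Ideal.eq_top_iff_one _).2 h)
    have h1 := hgor.2
    rw [Module.finrank_zero_of_subsingleton] at h1
    omega
  obtain ⟨s, hsd, hs0, hs1⟩ : ∃ s, s ≤ d ∧ HFq k J s ≠ 0 ∧ HFq k J (s + 1) = 0 := by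
    classical
    have hex : ∃ m, HFq k J m = 0 := ⟨d + 1, HFq_eq_zero_iff.2 hvan⟩
    obtain ⟨s, hs⟩ : ∃ s, Nat.find hex = s + 1 := by
      refine Nat.exists_eq_succ_of_ne_zero fun h0 => ?_
      have := Nat.find_spec hex
      rw [h0, HFq_eq_zero_iff] at this
      exact hone (this 1 (isHomogeneous_one _ _))
    refine ⟨s, ?_, Nat.find_min hex (by omega), hs ▸ Nat.find_spec hex⟩
    have := Nat.find_min' hex (HFq_eq_zero_iff.2 hvan)
    omega
  have hsoc : SocDeg J s := by
    refine ⟨homI_redIdeal (homI_srIdeal D) c, hgor, HFq_eq_zero_iff.1 hs1, ?_⟩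
    by_contra! H
    exact hs0 (HFq_eq_zero_iff.2 H)
  obtain ⟨i, hi⟩ : ∃ i, HFq k (redIdeal k (linkIdeal k D {i}) c) s ≠ 0 := by
    by_contra! H
    have hsum := sum_HFq_link_red hreg hc s
    simp only [H, ← hJ, hs1] at hsum
    have h1 : (((d + 1 : ℕ) : ℤ) - s) * (HFq k J s : ℤ) = 0 := by simpa using hsum.symm
    rcases mul_eq_zero.1 h1 with h | h <;> omega
  have hIL : srIdeal k D ≤ linkIdeal k D {i} := by
    rw [← linkIdeal_empty]
    exact linkIdeal_mono D (Finset.empty_subset _)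
  have hJL : J ≤ redIdeal k (linkIdeal k D {i}) c := sup_le_sup_right hIL _
  have hLJ : linkIdeal k D {i} ≤ J := by
    by_contra hnot
    apply hi
    obtain ⟨f, hf, hfJ⟩ := SetLike.not_le_iff_exists.1 hnot
    obtain ⟨j, hj⟩ : ∃ j, homogeneousComponent j f ∉ J := by
      by_contra! H
      exact hfJ (mem_of_homogeneousComponent_mem H)
    have hfj := homogeneousComponent_isHomogeneous j f
    have hjs : j ≤ s := by
      by_contra hlt
      exact hj (mem_of_isHomogeneous_le hsoc.vanish (by omega) hfj)
    obtain ⟨b, hb, hab⟩ := hsoc.exists_mul_notMem (s - j) (by omega) hfj hj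
    rw [HFq_eq_zero_iff]
    intro a ha
    have hv := hfj.mul hb
    rw [show j + (s - j) = s by omega] at hv
    obtain ⟨r, hr⟩ := exists_sub_smul_mem_of_socle hgor hab (hsoc.X_mul_mem hv) (hsoc.X_mul_mem ha)
    have h1 : homogeneousComponent j f * b ∈ redIdeal k (linkIdeal k D {i}) c :=
      Ideal.mem_sup_left (Ideal.mul_mem_right _ _ (homI_linkIdeal D {i} f hf j))
    have h2 := Ideal.add_mem _ (hJL hr) (Submodule.smul_of_tower_mem _ r h1)
    rwa [sub_add_cancel] at h2
  have heq : redIdeal k (linkIdeal k D {i}) c = J :=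
    le_antisymm (sup_le hLJ le_sup_right) hJL
  have hHs : Hs (srIdeal k D) = Hs (linkIdeal k D {i}) := by
    have h1 := Hs_linkIdeal_red hreg i (hc i)
    rw [heq, hJ, Hs_srIdeal_red hreg] at h1
    refine mul_left_cancel₀ (pow_ne_zero _ ?_) h1
    intro h0
    have := congrArg (PowerSeries.coeff 0) h0
    simp at this
  have hI : srIdeal k D = linkIdeal k D {i} :=
    eq_of_HFq_eq hIL (homI_linkIdeal D {i}) fun m => by
      have := congrArg (PowerSeries.coeff m) hHs
      simpa [Hs] using this
  obtain ⟨τ, hτ, hτi⟩ := h3 i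
  have hsupp : ∀ b ∈ (monomial (chi τ) (1 : k)).support, b.support = τ := by
    intro b hb
    rw [Finset.mem_singleton.1 (support_monomial_subset hb)]
    simpa using support_chi_add τ 0
  have hmem : monomial (chi τ) (1 : k) ∈ linkIdeal k D {i} := by
    rw [mem_linkIdeal]
    intro b hb
    rwa [hsupp b hb, Finset.union_comm, ← Finset.insert_eq]
  rw [← hI, mem_srIdeal] at hmem
  have hb : chi τ ∈ (monomial (chi τ) (1 : k)).support := by
    rw [mem_support_iff, coeff_monomial, if_pos rfl]
    exact one_ne_zero
  have := hmem _ hb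
  rw [hsupp _ hb] at this
  exact this hτ

lemma dep_of_depthGE {J : Ideal (MvPolynomial ι k)} {d : ℕ} (h : depthGE k J d) :
    Dep (irr k ι) d J := by
  obtain ⟨rs, rfl, hrs, hreg⟩ := h
  refine Reg.dep rs hrs J (Reg.of_isWeaklyRegular rs J ?_)
  exact (RingTheory.Sequence.isWeaklyRegular_map_algebraMap_iff _ _ _).1 hreg.toIsWeaklyRegular

lemma exists_generic_socDeg [Infinite k] {D : SC n} (hD : gorStar k D) (h1 : 1 ≤ dimP D) :
    ∃ g : MvPolynomial (Fin (dimP D) × Fin n) k, g ≠ 0 ∧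
      ∀ c, eval c g ≠ 0 → SocDeg (redIdeal k (srIdeal k D) c) (dimP D) := by
  obtain ⟨-, ⟨⟨-, hdep⟩, gG, hG0, hG⟩, h3⟩ := hD
  have hI := homI_srIdeal (k := k) D
  obtain ⟨gv, hv0, hv⟩ := exists_open_redIdeal hI
    (fun p : Fin (dimP D) × Fin n => (Infinite.natEmbedding k p.2) ^ (p.1 : ℕ)) (dimP D) (by
      intro a ha
      have := mem_redIdeal_of_degree_gt (D := D) (t := fun i : Fin n => Infinite.natEmbedding k i)
        (fun i j hij => Fin.ext ((Infinite.natEmbedding k).injective hij)) ∅ (by simp) ha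
      rwa [linkIdeal_empty] at this)
  refine ⟨gG * gv, mul_ne_zero hG0 (ne_zero_of_eval_ne_zero hv0), fun c hc => ?_⟩
  rw [eval_mul] at hc
  refine ⟨homI_redIdeal hI c, hG c (left_ne_zero_of_mul hc), hv c (right_ne_zero_of_mul hc), ?_⟩
  by_contra! H
  obtain ⟨d, hd⟩ : ∃ d, dimP D = d + 1 := ⟨dimP D - 1, by omega⟩
  generalize dimP D = e at *
  subst hd
  obtain ⟨g', hg0', hg'⟩ := exists_open_redIdeal hI c d H
  have hX : (∏ i, X (0, i) : MvPolynomial (Fin (d + 1) × Fin n) k) ≠ 0 :=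
    Finset.prod_ne_zero_iff.2 fun i _ => X_ne_zero _
  obtain ⟨c', hc', hreg⟩ := exists_reg_formList (d + 1) (srIdeal k D) (dep_of_depthGE hdep)
    (gG * g' * ∏ i, X (0, i))
    (mul_ne_zero (mul_ne_zero hG0 (ne_zero_of_eval_ne_zero hg0')) hX)
  rw [eval_mul, eval_mul, eval_prod] at hc'
  refine false_of_early_socle hreg (fun i => ?_)
    (hG c' (left_ne_zero_of_mul (left_ne_zero_of_mul hc')))
    (hg' c' (right_ne_zero_of_mul (left_ne_zero_of_mul hc'))) h3
  simpa using Finset.prod_ne_zero_iff.1 (right_ne_zero_of_mul hc') i (Finset.mem_univ i)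

end SocleDegree

section LefschetzOfSurjective

variable {k}

lemma exists_homogeneous_of_mem_sup_singleton {J : Ideal (MvPolynomial ι k)} (hJ : HomI J)
    {ω : MvPolynomial ι k} (hω : ω.IsHomogeneous 1) {m : ℕ} {a : MvPolynomial ι k}
    (ha : a.IsHomogeneous (m + 1)) (h : a ∈ J ⊔ Ideal.span {ω}) :
    ∃ b : MvPolynomial ι k, b.IsHomogeneous m ∧ a - ω * b ∈ J := by
  obtain ⟨f, hf, z, hz, rfl⟩ := Submodule.mem_sup.1 h
  obtain ⟨b, rfl⟩ := Ideal.mem_span_singleton'.1 hz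
  refine ⟨homogeneousComponent m b, homogeneousComponent_isHomogeneous _ _, ?_⟩
  have h1 := hJ f hf (m + 1)
  have h2 : f = (f + b * ω) - ω * b := by ring
  rwa [h2, _root_.map_sub, homogeneousComponent_eq_self ha, homogeneousComponent_succ_mul hω] at h1

lemma SocDeg.mulMaxRank {J : Ideal (MvPolynomial ι k)} {s : ℕ} (h : SocDeg J s)
    {ω : MvPolynomial ι k} (hω : ω.IsHomogeneous 1)
    (hsurj : ∀ a : MvPolynomial ι k, a.IsHomogeneous (s / 2 + 1) → a ∈ J ⊔ Ideal.span {ω})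
    (m : ℕ) : mulMaxRank k J (Ideal.Quotient.mk J ω) m := by
  have key : ∀ m, s / 2 ≤ m → ∀ a : MvPolynomial ι k, a.IsHomogeneous (m + 1) →
      ∃ b : MvPolynomial ι k, b.IsHomogeneous m ∧ a - ω * b ∈ J := fun m hm a ha =>
    exists_homogeneous_of_mem_sup_singleton h.hom hω ha
      (mem_of_isHomogeneous_le hsurj (by omega) ha)
  rcases le_or_gt (s / 2) m with hm | hm
  · right
    rintro _ ⟨a, ha, rfl⟩
    obtain ⟨b, hb, hab⟩ := key m hm a ha
    refine ⟨_, mk_mem_qComp hb, ?_⟩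
    rw [← map_mul]
    exact (Ideal.Quotient.eq.2 hab).symm
  · left
    rintro _ ⟨a, ha, rfl⟩ h0
    refine Ideal.Quotient.eq_zero_iff_mem.2 ?_
    refine h.mul_injective_of_surjective (m := s - 1 - m) (by omega)
      (key (s - 1 - m) (by omega)) ha ?_
    exact Ideal.Quotient.eq_zero_iff_mem.1 h0

/-- The tuple of linear forms `c` followed by the linear form `w`. -/
def consForm {R : Type*} {d : ℕ} (c : Fin d × ι → R) (w : ι → R) : Fin (d + 1) × ι → R :=
  fun p => Fin.lastCases (motive := fun _ => R) (w p.2) (fun j => c (j, p.2)) p.1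

lemma consForm_castSucc {R : Type*} {d : ℕ} (c : Fin d × ι → R) (w : ι → R) (j : Fin d) (i : ι) :
    consForm c w (j.castSucc, i) = c (j, i) := by
  simp [consForm]

lemma consForm_last {R : Type*} {d : ℕ} (c : Fin d × ι → R) (w : ι → R) (i : ι) :
    consForm c w (Fin.last d, i) = w i := by
  simp [consForm]

lemma exists_eq_consForm {R : Type*} {d : ℕ} (c : Fin (d + 1) × ι → R) :
    ∃ c' w, c = consForm c' w := by
  refine ⟨fun p => c (p.1.castSucc, p.2), fun i => c (Fin.last d, i), ?_⟩
  ext ⟨j, i⟩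
  refine Fin.lastCases ?_ (fun j => ?_) j
  · rw [consForm_last]
  · rw [consForm_castSucc]

lemma redIdeal_consForm (J : Ideal (MvPolynomial ι k)) {d : ℕ} (c : Fin d × ι → k) (w : ι → k) :
    redIdeal k J (consForm c w) = redIdeal k J c ⊔ Ideal.span {linForm k w} := by
  rw [redIdeal, redIdeal, sup_assoc, ← Ideal.span_union]
  congr 2
  ext f
  constructor
  · rintro ⟨j, rfl⟩
    refine Fin.lastCases ?_ (fun j => ?_) j
    · right
      simp [consForm_last]
    · left
      exact ⟨j, by simp [consForm_castSucc]⟩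
  · rintro (⟨j, rfl⟩ | rfl)
    · exact ⟨j.castSucc, by simp [consForm_castSucc]⟩
    · exact ⟨Fin.last d, by simp [consForm_last]⟩

lemma exists_restrict_left {d : ℕ} (g : MvPolynomial (Fin (d + 1) × ι) k) (w : ι → k) :
    ∃ g' : MvPolynomial (Fin d × ι) k, ∀ c, eval c g' = eval (consForm c w) g := by
  refine ⟨bind₁ (consForm X fun i => C (w i)) g, fun c => ?_⟩
  rw [eval_bind₁_eq]
  congr 2
  ext ⟨j, i⟩
  refine Fin.lastCases ?_ (fun j => ?_) j
  · simp only [consForm_last, eval_C]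
  · simp only [consForm_castSucc, eval_X]

lemma exists_restrict_right {d : ℕ} (g : MvPolynomial (Fin (d + 1) × ι) k) (c : Fin d × ι → k) :
    ∃ g' : MvPolynomial ι k, ∀ w, eval w g' = eval (consForm c w) g := by
  refine ⟨bind₁ (consForm (fun p => C (c p)) X) g, fun w => ?_⟩
  rw [eval_bind₁_eq]
  congr 2
  ext ⟨j, i⟩
  refine Fin.lastCases ?_ (fun j => ?_) j
  · simp only [consForm_last, eval_X]
  · simp only [consForm_castSucc, eval_C]

lemma hasWLP_of_surjective {J : Ideal (MvPolynomial ι k)} {d : ℕ} (hCM : isCM k J d) (hJ : HomI J)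
    {g : MvPolynomial (Fin d × ι) k} (hg0 : g ≠ 0)
    (hg : ∀ c, eval c g ≠ 0 → SocDeg (redIdeal k J c) d)
    (c₀ : Fin d × ι → k) (w₀ : ι → k)
    (h₀ : ∀ a : MvPolynomial ι k, a.IsHomogeneous (d / 2 + 1) →
      a ∈ redIdeal k J c₀ ⊔ Ideal.span {linForm k w₀}) : hasWLP k J d := by
  refine ⟨hCM, ?_⟩
  obtain ⟨G, hG0, hG⟩ := exists_open_redIdeal hJ (consForm c₀ w₀) (d / 2)
    (by rwa [redIdeal_consForm])
  obtain ⟨G₁, hG₁⟩ := exists_restrict_left G w₀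
  refine ⟨g * G₁, mul_ne_zero hg0 (ne_zero_of_eval_ne_zero (hG₁ c₀ ▸ hG0)), fun c hc => ?_⟩
  rw [eval_mul] at hc
  obtain ⟨G₂, hG₂⟩ := exists_restrict_right G c
  refine ⟨G₂, ne_zero_of_eval_ne_zero (c := w₀) ?_, fun w hw m => ?_⟩
  · rw [hG₂, ← hG₁]
    exact right_ne_zero_of_mul hc
  · refine (hg c (left_ne_zero_of_mul hc)).mulMaxRank (isHomogeneous_linForm w) ?_ m
    rw [hG₂] at hw
    have := hG _ hw
    rwa [redIdeal_consForm] at this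

end LefschetzOfSurjective

section Stellar

variable {k}

/-- The retraction `R[T] → R` sending `T` to `0`. -/
def killT : MvPolynomial (Fin (n + 1)) k →ₐ[k] MvPolynomial (Fin n) k :=
  aeval (Fin.lastCases (motive := fun _ => MvPolynomial (Fin n) k) 0 X)

lemma killT_X_last : killT (X (Fin.last n) : MvPolynomial (Fin (n + 1)) k) = 0 := by
  simp [killT]

lemma killT_X_castSucc (i : Fin n) :
    killT (X i.castSucc : MvPolynomial (Fin (n + 1)) k) = X i := by
  simp [killT]

lemma killT_toT (f : MvPolynomial (Fin n) k) : killT (toT k f) = f := by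
  have h : (killT.comp (toT k) : MvPolynomial (Fin n) k →ₐ[k] MvPolynomial (Fin n) k) =
      AlgHom.id k _ := by
    refine algHom_ext fun i => ?_
    simp [toT, killT_X_castSucc]
  exact DFunLike.congr_fun h f

lemma killT_isHomogeneous {f : MvPolynomial (Fin (n + 1)) k} {m : ℕ} (hf : f.IsHomogeneous m) :
    (killT f).IsHomogeneous m := by
  have := hf.aeval (S := k) (Fin.lastCases (motive := fun _ => MvPolynomial (Fin n) k) 0 X)
    (n := 1) (fun i => by
      refine Fin.lastCases ?_ (fun i => ?_) i
      · simpa using isHomogeneous_zero _ _ _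
      · simpa using isHomogeneous_X k i)
  rwa [one_mul] at this

lemma toT_isHomogeneous {f : MvPolynomial (Fin n) k} {m : ℕ} (hf : f.IsHomogeneous m) :
    (toT k f).IsHomogeneous m :=
  hf.rename_isHomogeneous

lemma sub_toT_killT_mem (f : MvPolynomial (Fin (n + 1)) k) :
    f - toT k (killT f) ∈ Ideal.span {Tv k n} := by
  have h : Ideal.Quotient.mkₐ k (Ideal.span {Tv k n}) =
      (Ideal.Quotient.mkₐ k (Ideal.span {Tv k n})).comp ((toT k).comp killT) := by
    refine algHom_ext fun i => ?_
    refine Fin.lastCases ?_ (fun i => ?_) i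
    · simp only [AlgHom.comp_apply, killT_X_last, map_zero]
      exact Ideal.Quotient.eq_zero_iff_mem.2 (Ideal.mem_span_singleton_self _)
    · simp [killT_X_castSucc, toT]
  exact Ideal.Quotient.eq.1 (DFunLike.congr_fun h f)

lemma linForm_eq_toT_add (w : Fin (n + 1) → k) :
    linForm k w = toT k (linForm k fun i => w i.castSucc) + C (w (Fin.last n)) * Tv k n := by
  rw [linForm, Fin.sum_univ_castSucc, linForm, map_sum]
  simp [toT, Tv]

lemma killT_linForm (w : Fin (n + 1) → k) :
    killT (linForm k w) = linForm k fun i => w i.castSucc := by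
  rw [linForm_eq_toT_add, map_add, killT_toT, map_mul, Tv, killT_X_last, mul_zero, add_zero]

lemma homI_extI {J : Ideal (MvPolynomial (Fin n) k)} (hJ : HomI J) : HomI (extI k J) := by
  have h : extI k J = Ideal.span (toT k '' {f | f ∈ J ∧ ∃ m, f.IsHomogeneous m}) := by
    refine le_antisymm (Ideal.map_le_iff_le_comap.2 fun f hf => ?_) (Ideal.span_mono ?_)
    · rw [Ideal.mem_comap, ← sum_homogeneousComponent f, map_sum]
      exact Ideal.sum_mem _ fun m _ => Ideal.subset_span
        ⟨_, ⟨hJ f hf m, m, homogeneousComponent_isHomogeneous m f⟩, rfl⟩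
    · exact Set.image_mono fun f hf => hf.1
  rw [h]
  refine HomI.span ?_
  rintro _ ⟨f, ⟨-, m, hm⟩, rfl⟩
  exact ⟨m, toT_isHomogeneous hm⟩

/-- Truncation of coefficient tuples of linear forms of `R[T]` to linear forms of `R`. -/
def truncForm {d : ℕ} (c : Fin d × Fin (n + 1) → k) : Fin d × Fin n → k :=
  fun p => c (p.1, p.2.castSucc)

lemma exists_open_link [Infinite k] (D : SC n) (σ : Finset (Fin n)) {m : ℕ}
    (hm : dimP D < m + 1 + σ.card) :
    ∃ g : MvPolynomial (Fin (dimP D + 1) × Fin (n + 1)) k, g ≠ 0 ∧ ∀ c, eval c g ≠ 0 →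
      ∀ a : MvPolynomial (Fin (n + 1)) k, a.IsHomogeneous (m + 1) →
        a ∈ redIdeal k (extI k (linkIdeal k D σ)) c := by
  let t : Fin n → k := fun i => Infinite.natEmbedding k i
  have ht : Function.Injective t := fun i j hij =>
    Fin.ext ((Infinite.natEmbedding k).injective hij)
  let c : Fin (dimP D) × Fin (n + 1) → k := fun p =>
    Fin.lastCases (motive := fun _ => k) 0 (fun i => t i ^ (p.1 : ℕ)) p.2
  obtain ⟨g, hg0, hg⟩ := exists_open_redIdeal (homI_extI (homI_linkIdeal D σ))
    (consForm c (Pi.single (Fin.last n) 1)) m (by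
      intro a ha
      rw [redIdeal_consForm, linForm_single, ← sub_add_cancel a (toT k (killT a))]
      refine Ideal.add_mem _ (Ideal.mem_sup_right (sub_toT_killT_mem a)) (Ideal.mem_sup_left ?_)
      have h1 := mem_redIdeal_of_degree_gt ht σ hm (killT_isHomogeneous ha)
      obtain ⟨b, hb⟩ := mem_redIdeal.1 h1
      refine mem_redIdeal.2 ⟨fun j => toT k (b j), ?_⟩
      have h2 := Ideal.mem_map_of_mem (toT k) hb
      rw [_root_.map_sub, map_sum] at h2
      rw [extI]
      convert h2 using 3 with j
      rw [map_mul, linForm_eq_toT_add]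
      simp [c])
  exact ⟨g, ne_zero_of_eval_ne_zero hg0, hg⟩

lemma killT_mem_of_mem_Jst {D : SC n} {σ : Finset (Fin n)} {f : MvPolynomial (Fin (n + 1)) k}
    (hf : f ∈ Jst k D σ) : killT f ∈ srIdeal k D ⊔ Ideal.span {xFace k σ} := by
  have h : Jst k D σ ≤ (srIdeal k D ⊔ Ideal.span {xFace k σ}).comap killT := by
    refine sup_le (sup_le (Ideal.map_le_iff_le_comap.2 fun f hf => ?_) ?_) ?_
    · rw [Ideal.mem_comap, Ideal.mem_comap, killT_toT]
      exact Ideal.mem_sup_left hf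
    · rw [Ideal.span_singleton_le_iff_mem, Ideal.mem_comap, killT_toT]
      exact Ideal.mem_sup_right (Ideal.mem_span_singleton_self _)
    · refine Ideal.span_le.2 ?_
      rintro _ ⟨f, -, rfl⟩
      simp only [SetLike.mem_coe, Ideal.mem_comap, map_mul, Tv, killT_X_last, zero_mul]
      exact Ideal.zero_mem _
  exact h hf

lemma isHomogeneous_xFace (σ : Finset (Fin n)) : (xFace k σ).IsHomogeneous σ.card := by
  have := IsHomogeneous.prod σ (fun i => (X i : MvPolynomial (Fin n) k)) (fun _ => 1)
    fun i _ => isHomogeneous_X k i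
  simpa [xFace] using this

lemma killT_mem_redIdeal {D : SC n} {σ : Finset (Fin n)} {d : ℕ} {c : Fin d × Fin (n + 1) → k}
    {f : MvPolynomial (Fin (n + 1)) k} {e : ℕ} (hf : f.IsHomogeneous e) (he : e < σ.card)
    (h : f ∈ redIdeal k (Jst k D σ) c) : killT f ∈ redIdeal k (srIdeal k D) (truncForm c) := by
  obtain ⟨b, hb⟩ := mem_redIdeal.1 h
  have h1 := killT_mem_of_mem_Jst hb
  rw [mem_sup_span_singleton_iff] at h1
  obtain ⟨a, ha⟩ := h1
  have h2 : killT f - xFace k σ * a ∈ redIdeal k (srIdeal k D) (truncForm c) := by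
    refine mem_redIdeal.2 ⟨fun j => killT (b j), ?_⟩
    convert ha using 1
    rw [_root_.map_sub, map_sum]
    simp only [map_mul, killT_linForm, truncForm]
    ring
  have h3 := homI_redIdeal (homI_srIdeal D) (truncForm c) _ h2 e
  rwa [_root_.map_sub, homogeneousComponent_eq_self (killT_isHomogeneous hf),
    homogeneousComponent_mul_of_isHomogeneous (isHomogeneous_xFace σ), if_neg (by omega),
    sub_zero] at h3

lemma Tv_mul_mem {D : SC n} {σ : Finset (Fin n)} {d : ℕ} {c : Fin d × Fin (n + 1) → k}
    {f : MvPolynomial (Fin (n + 1)) k} (h : f ∈ redIdeal k (extI k (linkIdeal k D σ)) c) :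
    Tv k n * f ∈ redIdeal k (Jst k D σ) c := by
  obtain ⟨b, hb⟩ := mem_redIdeal.1 h
  refine mem_redIdeal.2 ⟨fun j => Tv k n * b j, ?_⟩
  have h1 : extI k (linkIdeal k D σ) ≤ Submodule.comap (LinearMap.mulLeft _ (Tv k n))
      (Jst k D σ) := by
    refine Ideal.span_le.2 ?_
    rintro _ ⟨f, hf, rfl⟩
    exact Ideal.mem_sup_right (Ideal.subset_span ⟨f, hf, rfl⟩)
  have h2 : Tv k n * (f - ∑ j, linForm k (fun i => c (j, i)) * b j) ∈ Jst k D σ := h1 hb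
  rw [mul_sub, Finset.mul_sum] at h2
  convert h2 using 3
  ring

lemma mem_of_linForm_mul_mem {D : SC n} {σ : Finset (Fin n)} {d : ℕ}
    {c : Fin d × Fin (n + 1) → k} {w : Fin (n + 1) → k} {m : ℕ} (hm : m + 1 < σ.card)
    (hlink : ∀ a : MvPolynomial (Fin (n + 1)) k, a.IsHomogeneous (m + 1) →
      a ∈ redIdeal k (extI k (linkIdeal k D σ)) (consForm c w))
    (hinj : ∀ a : MvPolynomial (Fin (n + 1)) k, a.IsHomogeneous (m + 1) →
      linForm k w * a ∈ redIdeal k (Jst k D σ) c → a ∈ redIdeal k (Jst k D σ) c)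
    {a : MvPolynomial (Fin n) k} (ha : a.IsHomogeneous (m + 1))
    (h : linForm k (fun i => w i.castSucc) * a ∈ redIdeal k (srIdeal k D) (truncForm c)) :
    a ∈ redIdeal k (srIdeal k D) (truncForm c) := by
  obtain ⟨b, hb, hab⟩ := exists_homogeneous_of_mem_redIdeal (homI_srIdeal D)
    (by rw [add_comm]; exact (isHomogeneous_linForm _).mul ha) h
  set r : MvPolynomial (Fin (n + 1)) k :=
    ∑ j, C (c (j, Fin.last n)) * toT k (b j) - C (w (Fin.last n)) * toT k a with hr
  have hrhom : r.IsHomogeneous (m + 1) :=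
    (IsHomogeneous.sum _ _ _ fun j _ => (toT_isHomogeneous (hb j)).C_mul _).sub
      ((toT_isHomogeneous ha).C_mul _)
  have hrl := hlink r hrhom
  rw [redIdeal_consForm] at hrl
  obtain ⟨s, hs, hrs⟩ := exists_homogeneous_of_mem_sup_singleton
    (homI_redIdeal (homI_extI (homI_linkIdeal D σ)) c) (isHomogeneous_linForm w) hrhom hrl
  have hhom : (toT k a + Tv k n * s).IsHomogeneous (m + 1) :=
    (toT_isHomogeneous ha).add (by rw [add_comm m]; exact (isHomogeneous_X k _).mul hs)
  have hI : toT k (linForm k (fun i => w i.castSucc) * a -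
      ∑ j, linForm k (fun i => truncForm c (j, i)) * b j) ∈ redIdeal k (Jst k D σ) c :=
    Ideal.mem_sup_left (Ideal.mem_sup_left (Ideal.mem_sup_left (Ideal.mem_map_of_mem _ hab)))
  have hθ : ∑ j, linForm k (fun i => c (j, i)) * toT k (b j) ∈ redIdeal k (Jst k D σ) c :=
    Ideal.sum_mem _ fun j _ => Ideal.mul_mem_right _ _
      (Ideal.mem_sup_right (Ideal.subset_span ⟨j, rfl⟩))
  have hmul : linForm k w * (toT k a + Tv k n * s) ∈ redIdeal k (Jst k D σ) c := by
    convert Ideal.sub_mem _ (Ideal.add_mem _ hI hθ) (Tv_mul_mem hrs) using 1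
    have h1 : ∑ j, linForm k (fun i => c (j, i)) * toT k (b j) =
        ∑ j, toT k (linForm k fun i => truncForm c (j, i)) * toT k (b j) +
          Tv k n * ∑ j, C (c (j, Fin.last n)) * toT k (b j) := by
      rw [Finset.mul_sum, ← Finset.sum_add_distrib]
      refine Finset.sum_congr rfl fun j _ => ?_
      rw [linForm_eq_toT_add]
      simp only [truncForm]
      ring
    rw [h1, _root_.map_sub, map_sum, map_mul]
    simp only [map_mul]
    rw [hr, linForm_eq_toT_add w]
    ring
  have := killT_mem_redIdeal hhom hm (hinj _ hhom hmul)
  rwa [map_add, killT_toT, map_mul, Tv, killT_X_last, zero_mul, add_zero] at this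

lemma mem_of_mulMaxRank_Jst {D : SC n} {σ : Finset (Fin n)} {d : ℕ}
    {c : Fin d × Fin (n + 1) → k} {w : Fin (n + 1) → k} {m : ℕ} (hm : m + 1 + (d / 2 + 1) = d)
    (hσ : d / 2 + 1 < σ.card)
    (hsoc : SocDeg (redIdeal k (srIdeal k D) (truncForm c)) d)
    (hlink : ∀ a : MvPolynomial (Fin (n + 1)) k, a.IsHomogeneous (m + 1) →
      a ∈ redIdeal k (extI k (linkIdeal k D σ)) (consForm c w))
    (hmax : mulMaxRank k (redIdeal k (Jst k D σ) c) (Ideal.Quotient.mk _ (linForm k w)) (m + 1))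
    {a : MvPolynomial (Fin n) k} (ha : a.IsHomogeneous (d / 2 + 1)) :
    a ∈ redIdeal k (srIdeal k D) (truncForm c) ⊔
      Ideal.span {linForm k fun i => w i.castSucc} := by
  rw [mem_sup_span_singleton_iff]
  rcases hmax with hinj | hsurj
  · have hinj' : ∀ x : MvPolynomial (Fin (n + 1)) k, x.IsHomogeneous (m + 1) →
        linForm k w * x ∈ redIdeal k (Jst k D σ) c → x ∈ redIdeal k (Jst k D σ) c := by
      intro x hx hwx
      refine Ideal.Quotient.eq_zero_iff_mem.1 (hinj _ (mk_mem_qComp hx) ?_)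
      rw [← map_mul]
      exact Ideal.Quotient.eq_zero_iff_mem.2 hwx
    obtain ⟨b, -, hb⟩ := hsoc.mul_surjective_of_injective (isHomogeneous_linForm _) hm
      (fun a ha h => mem_of_linForm_mul_mem (by omega) hlink hinj' ha h) ha
    exact ⟨b, hb⟩
  · rw [← mem_sup_span_singleton_iff]
    refine mem_of_isHomogeneous_le (m := m + 2) (fun x hx => ?_) (by omega) ha
    obtain ⟨_, ⟨y, hy, rfl⟩, hxy⟩ := hsurj _ (mk_mem_qComp (toT_isHomogeneous hx))
    have h1 : linForm k w * y - toT k x ∈ redIdeal k (Jst k D σ) c := by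
      refine Ideal.Quotient.eq.1 ?_
      rw [map_mul]
      exact hxy
    have h2 : (linForm k w * y - toT k x).IsHomogeneous (m + 2) := by
      refine IsHomogeneous.sub ?_ (toT_isHomogeneous hx)
      rw [show m + 2 = 1 + (m + 1) by ring]
      exact (isHomogeneous_linForm w).mul hy
    have h3 := killT_mem_redIdeal h2 (by omega) h1
    rw [_root_.map_sub, map_mul, killT_toT, killT_linForm] at h3
    rw [mem_sup_span_singleton_iff]
    refine ⟨killT y, ?_⟩
    rw [← neg_sub]
    exact neg_mem h3

end Stellar

/-- **Theorem.** If `q > p₂` and `k[D_σ]` has the WLP, then `k[D]` has the WLP. -/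
theorem wlp_of_wlp_stellar (k : Type) [Field k] [Infinite k]
    (n q d : ℕ) (hq : 1 ≤ q)
    (D : SC n) (hD : gorStar k D)
    (σ : Finset (Fin n)) (hσ : σ ∈ D.faces) (hcard : σ.card = q + 1)
    (hd : d = dimP D)
    (h2q : d / 2 < q)
    (hW : hasWLP k (Jst k D σ) d) :
    hasWLP k (srIdeal k D) d := by
  subst hd
  have hqd : q + 1 ≤ dimP D := hcard ▸ Finset.le_sup (f := Finset.card) hσ
  obtain ⟨m, hm⟩ : ∃ m, m + 1 + (dimP D / 2 + 1) = dimP D := ⟨dimP D - dimP D / 2 - 2, by omega⟩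
  obtain ⟨gs, hgs0, hgs⟩ := exists_generic_socDeg hD (by omega)
  obtain ⟨gl, hgl0, hgl⟩ := exists_open_link (k := k) D σ (m := m) (by omega)
  obtain ⟨-, gW, hgW0, hgW⟩ := hW
  obtain ⟨p, hp⟩ := exists_eval_ne_zero hgl0
  obtain ⟨c₀, w₀, rfl⟩ := exists_eq_consForm p
  obtain ⟨gl₁, hgl₁⟩ := exists_restrict_left gl w₀
  have hinj : Function.Injective
      (Prod.map id Fin.castSucc : Fin (dimP D) × Fin n → Fin (dimP D) × Fin (n + 1)) :=
    Function.injective_id.prodMap (Fin.castSucc_injective n)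
  obtain ⟨c, hc⟩ := exists_eval_ne_zero (mul_ne_zero (mul_ne_zero hgW0
    (ne_zero_of_eval_ne_zero (hgl₁ c₀ ▸ hp)))
    ((map_ne_zero_iff _ (rename_injective _ hinj)).2 hgs0))
  rw [eval_mul, eval_mul, eval_rename] at hc
  obtain ⟨gw, hgw0, hgw⟩ := hgW c (left_ne_zero_of_mul (left_ne_zero_of_mul hc))
  obtain ⟨gl₂, hgl₂⟩ := exists_restrict_right gl c
  have hgl₂0 : gl₂ ≠ 0 := ne_zero_of_eval_ne_zero (c := w₀) (by
    rw [hgl₂, ← hgl₁]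
    exact right_ne_zero_of_mul (left_ne_zero_of_mul hc))
  obtain ⟨w, hw⟩ := exists_eval_ne_zero (mul_ne_zero hgw0 hgl₂0)
  rw [eval_mul, hgl₂] at hw
  exact hasWLP_of_surjective hD.2.1.1 (homI_srIdeal D) hgs0 hgs (truncForm c)
    (fun i => w i.castSucc) fun a ha => mem_of_mulMaxRank_Jst hm (by omega)
      (hgs _ (right_ne_zero_of_mul hc)) (hgl _ (right_ne_zero_of_mul hw))
      (hgw w (left_ne_zero_of_mul hw) (m + 1)) ha

end SRWLP
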